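/- Let Ω ⊂ ℝ⁴ be a connected open set, λ > 0, and let v ∈ C⁴(Ω) be a convex solution of equation (★). Suppose the Hessian ∇²v attains its minimal rank over Ω, equal to 2, at some point x₀ ∈ Ω (so rank(∇²v(x)) ≥ 2 for all x ∈ Ω and rank(∇²v(x₀)) = 2). Define φ(x) = σ₃(∇²v(x)) + q(x), where q(x) = σ₄(∇²v(x))/σ₃(∇²v(x)) if σ₃(∇²v(x)) > 0 and q(x) = 0 if σ₃(∇²v(x)) = 0. Then there exist an open neighborhood O ⊂ Ω of x₀ and a constant C > 0, independent of φ, such that ∑_{i,j=1}^4 F^{ij}(x) φ_{ij}(x) ≤ C(φ(x) + |∇φ(x)|) for all x ∈ O, the inequality being understood in the viscosity sense at points where φ is not twice differentiable. -/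

import Mathlib

/-- First-order real partial derivative `∂f/∂xᵢ` on `ℝ⁴ ≅ ℂ²`. -/
noncomputable def pd (f : (Fin 4 → ℝ) → ℝ) (i : Fin 4) (x : Fin 4 → ℝ) : ℝ :=
  fderiv ℝ f x (Pi.single i 1)

/-- Second-order real partial derivative `∂²f/∂xᵢ∂xⱼ`. -/
noncomputable def pd2 (f : (Fin 4 → ℝ) → ℝ) (i j : Fin 4) (x : Fin 4 → ℝ) : ℝ :=
  pd (fun y => pd f i y) j x

/-- The real Hessian matrix of `f` at `x`. -/
noncomputable def hessM (f : (Fin 4 → ℝ) → ℝ) (x : Fin 4 → ℝ) :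
    Matrix (Fin 4) (Fin 4) ℝ :=
  Matrix.of fun i j => pd2 f i j x

/-- Equation (★) (indices 1,2,3,4 are `0,1,2,3`). -/
def StarEq (lam : ℝ) (v : (Fin 4 → ℝ) → ℝ) (Ω : Set (Fin 4 → ℝ)) : Prop :=
  ∀ x ∈ Ω,
    (pd2 v 0 0 x + pd2 v 2 2 x) * (pd2 v 1 1 x + pd2 v 3 3 x)
      - (pd2 v 0 1 x + pd2 v 2 3 x)^2 - (pd2 v 0 3 x - pd2 v 1 2 x)^2
      - ((pd v 0 x)^2 + (pd v 2 x)^2) * (pd2 v 1 1 x + pd2 v 3 3 x)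
      - ((pd v 1 x)^2 + (pd v 3 x)^2) * (pd2 v 0 0 x + pd2 v 2 2 x)
      + 2 * (pd v 0 x * pd v 1 x + pd v 2 x * pd v 3 x) * (pd2 v 0 1 x + pd2 v 2 3 x)
      + 2 * (pd v 0 x * pd v 3 x - pd v 1 x * pd v 2 x) * (pd2 v 0 3 x - pd2 v 1 2 x)
      = lam

/-- The coefficient matrix `(F^{ij})` of the linearized operator of (★):
`F¹¹ = F³³ = v₂₂+v₄₄−(v₂²+v₄²)`, `F²² = F⁴⁴ = v₁₁+v₃₃−(v₁²+v₃²)`,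
`F¹² = F²¹ = F³⁴ = F⁴³ = (v₁v₂+v₃v₄)−(v₁₂+v₃₄)`,
`F¹⁴ = F⁴¹ = (v₁v₄−v₂v₃)−(v₁₄−v₂₃) = −F²³ = −F³²`, `F¹³ = F³¹ = F²⁴ = F⁴² = 0`. -/
noncomputable def Fm (v : (Fin 4 → ℝ) → ℝ) (x : Fin 4 → ℝ) :
    Matrix (Fin 4) (Fin 4) ℝ :=
  let a := pd2 v 1 1 x + pd2 v 3 3 x - ((pd v 1 x)^2 + (pd v 3 x)^2)
  let b := pd2 v 0 0 x + pd2 v 2 2 x - ((pd v 0 x)^2 + (pd v 2 x)^2)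
  let c := (pd v 0 x * pd v 1 x + pd v 2 x * pd v 3 x) - (pd2 v 0 1 x + pd2 v 2 3 x)
  let d := (pd v 0 x * pd v 3 x - pd v 1 x * pd v 2 x) - (pd2 v 0 3 x - pd2 v 1 2 x)
  !![a, c, 0, d;
     c, b, -d, 0;
     0, -d, a, c;
     d, 0, c, b]

/-- `σ₃` of a `4×4` matrix: the third elementary symmetric function of its
eigenvalues, i.e. the trace of the adjugate. -/
noncomputable def sigma3 (A : Matrix (Fin 4) (Fin 4) ℝ) : ℝ :=
  A.adjugate.trace

/-- Bian–Guan's quotient-type auxiliary function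
`φ = σ₃(∇²v) + q`, with `q = σ₄(∇²v)/σ₃(∇²v)` if `σ₃(∇²v) > 0` and `q = 0` otherwise. -/
noncomputable def phiBG (v : (Fin 4 → ℝ) → ℝ) (x : Fin 4 → ℝ) : ℝ :=
  sigma3 (hessM v x) +
    (if 0 < sigma3 (hessM v x) then (hessM v x).det / sigma3 (hessM v x) else 0)

/-- The polarization of the complex determinant of `K`. -/
def polarDet {A : Type*} [CommRing A] (K M : Fin 4 → Fin 4 → A) : A :=
  (K 1 1 + K 3 3) * (M 0 0 + M 2 2) + (K 0 0 + K 2 2) * (M 1 1 + M 3 3)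
    - 2 * (K 0 1 + K 2 3) * (M 0 1 + M 2 3) - 2 * (K 0 3 - K 1 2) * (M 0 3 - M 1 2)

theorem polarDet_rank_two_identity_aux {A : Type*} [CommRing A] (u w p : Fin 4 → A)
    (g₂ g₃ x y z : A) (K X : Fin 4 → Fin 4 → A)
    (hK : ∀ i j, K i j = g₂ * u i * u j + g₃ * w i * w j - p i * p j)
    (hX : ∀ i j, X i j = x * u i * u j + y * (u i * w j + w i * u j) + z * w i * w j) :
    - g₂ * g₃ * polarDet X X
      - 2 * g₃ * polarDet K (fun i j => (x * u i + y * w i) * (x * u j + y * w j))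
      - 2 * g₂ * polarDet K (fun i j => (y * u i + z * w i) * (y * u j + z * w j))
      = (x * z - y ^ 2) * polarDet K K - 2 * (x * g₃ + z * g₂) * polarDet K X := by
  simp only [polarDet, hK, hX]
  ring

theorem polarDet_rank_two_identity {A : Type*} [CommRing A] (u w p : Fin 4 → A)
    (g₂ g₃ h₂ h₃ x y z : A) (h2 : g₂ * h₂ = 1) (h3 : g₃ * h₃ = 1) (K X : Fin 4 → Fin 4 → A)
    (hK : ∀ i j, K i j = g₂ * u i * u j + g₃ * w i * w j - p i * p j)
    (hX : ∀ i j, X i j = x * u i * u j + y * (u i * w j + w i * u j) + z * w i * w j) :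
    - polarDet X X
      - 2 * h₂ * polarDet K (fun i j => (x * u i + y * w i) * (x * u j + y * w j))
      - 2 * h₃ * polarDet K (fun i j => (y * u i + z * w i) * (y * u j + z * w j))
      = h₂ * h₃ * (x * z - y ^ 2) * polarDet K K - 2 * (x * h₂ + z * h₃) * polarDet K X := by
  have key := polarDet_rank_two_identity_aux u w p g₂ g₃ x y z K X hK hX
  generalize polarDet X X = a at *
  generalize polarDet K (fun i j => (x * u i + y * w i) * (x * u j + y * w j)) = b at *
  generalize polarDet K (fun i j => (y * u i + z * w i) * (y * u j + z * w j)) = c at *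
  generalize polarDet K K = d at *
  generalize polarDet K X = f at *
  linear_combination (h₂ * h₃) * key + (a * (g₃ * h₃) + 2 * c * h₃ - 2 * h₃ * z * f) * h2
    + (a + 2 * b * h₂ - 2 * x * h₂ * f) * h3

/-- The ring of bounded real functions on a type. -/
def boundedFun (ι : Type*) : Subring (ι → ℝ) where
  carrier := {f | ∃ C, ∀ i, |f i| ≤ C}
  mul_mem' := by
    rintro f g ⟨C, hC⟩ ⟨D, hD⟩
    refine ⟨C * D, fun i => ?_⟩
    rw [Pi.mul_apply, abs_mul]
    exact mul_le_mul (hC i) (hD i) (abs_nonneg _) ((abs_nonneg _).trans (hC i))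
  one_mem' := ⟨1, fun i => by simp⟩
  add_mem' := by
    rintro f g ⟨C, hC⟩ ⟨D, hD⟩
    exact ⟨C + D, fun i => (abs_add_le _ _).trans (add_le_add (hC i) (hD i))⟩
  zero_mem' := ⟨0, fun i => by simp⟩
  neg_mem' := by
    rintro f ⟨C, hC⟩
    exact ⟨C, fun i => by simpa using hC i⟩

/-- The ideal of bounded functions that are `O(E)`. -/
def smallIdeal {ι : Type*} (E : ι → ℝ) : Ideal (boundedFun ι) where
  carrier := {f | ∃ C, ∀ i, |f.1 i| ≤ C * E i}
  add_mem' := by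
    rintro f g ⟨C, hC⟩ ⟨D, hD⟩
    refine ⟨C + D, fun i => ?_⟩
    rw [add_mul]
    exact (abs_add_le _ _).trans (add_le_add (hC i) (hD i))
  zero_mem' := ⟨0, fun i => by simp⟩
  smul_mem' := by
    rintro ⟨f, B, hB⟩ g ⟨C, hC⟩
    refine ⟨B * C, fun i => ?_⟩
    have : |f i * g.1 i| ≤ B * (C * E i) := by
      rw [abs_mul]
      exact mul_le_mul (hB i) (hC i) (abs_nonneg _) ((abs_nonneg _).trans (hB i))
    rw [mul_assoc]
    exact this

theorem mem_smallIdeal {ι : Type*} {E : ι → ℝ} {f : boundedFun ι} :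
    f ∈ smallIdeal E ↔ ∃ C, ∀ i, |f.1 i| ≤ C * E i := Iff.rfl

/-- Pointwise data of a solution in an eigenframe `e` of its Hessian, with eigenvalues `l`:
gradient `p`, third derivatives `X3` (all indices in the frame), `G` (two indices in the frame),
`Xo` (first index in the frame), fourth derivatives `Z`, weights `c`,
and first and second derivatives of a test function. -/
structure FrameData where
  p : Fin 4 → ℝ
  e : Fin 4 → Fin 4 → ℝ
  l : Fin 4 → ℝ
  c : Fin 4 → ℝ
  X3 : Fin 4 → Fin 4 → Fin 4 → ℝ
  G : Fin 4 → Fin 4 → Fin 4 → ℝ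
  Xo : Fin 4 → Fin 4 → Fin 4 → ℝ
  Z : Fin 4 → Fin 4 → Fin 4 → ℝ
  grad : Fin 4 → ℝ
  hess : Fin 4 → Fin 4 → ℝ

/-- The real form `H - p pᵀ` of the matrix whose complex determinant is prescribed. -/
def gradShift {A : Type*} [CommRing A] (l p : Fin 4 → A) (e : Fin 4 → Fin 4 → A)
    (i j : Fin 4) : A :=
  (∑ a, l a * e a i * e a j) - p i * p j

/-- First variation of `H - p pᵀ` along the eigenvector `e a`. -/
def gradShift₁ {A : Type*} [CommRing A] (l p : Fin 4 → A) (e : Fin 4 → Fin 4 → A)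
    (Xo : Fin 4 → Fin 4 → Fin 4 → A) (a i j : Fin 4) : A :=
  Xo a i j - p i * (l a * e a j) - (l a * e a i) * p j

/-- Second variation of `H - p pᵀ` along the eigenvector `e a`. -/
def gradShift₂ {A : Type*} [CommRing A] (l p : Fin 4 → A) (e : Fin 4 → Fin 4 → A)
    (G Z : Fin 4 → Fin 4 → Fin 4 → A) (a i j : Fin 4) : A :=
  Z a i j - p i * G a a j - G a a i * p j - 2 * (l a * e a i) * (l a * e a j)

/-- Vectors `ξ` with `∑ κ ξ ξᵀ` equal to the coefficient matrix. -/
def coeffVec {A : Type*} [CommRing A] (K : Fin 4 → Fin 4 → A) : Fin 4 → Fin 4 → A :=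
  ![![K 1 1 + K 3 3, -(K 0 1 + K 2 3), 0, -(K 0 3 - K 1 2)],
    ![0, K 0 3 - K 1 2, K 1 1 + K 3 3, -(K 0 1 + K 2 3)],
    ![0, 1, 0, 0],
    ![0, 0, 0, 1]]

/-- `σ₂` of the three eigenvalues other than the given one. -/
def sigma2Compl {A : Type*} [CommRing A] (l : Fin 4 → A) : Fin 4 → A :=
  ![l 1 * l 2 + l 1 * l 3 + l 2 * l 3, l 0 * l 2 + l 0 * l 3 + l 2 * l 3,
    l 0 * l 1 + l 0 * l 3 + l 1 * l 3, l 0 * l 1 + l 0 * l 2 + l 1 * l 2]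

/-- Twice the quadratic part of `σ₃` at a diagonal matrix. -/
def sigma3Quad {A : Type*} [CommRing A] (l : Fin 4 → A) (X : Fin 4 → Fin 4 → A) : A :=
  2 * ((l 2 + l 3) * (X 0 0 * X 1 1 - X 0 1 ^ 2) + (l 1 + l 3) * (X 0 0 * X 2 2 - X 0 2 ^ 2)
    + (l 1 + l 2) * (X 0 0 * X 3 3 - X 0 3 ^ 2) + (l 0 + l 3) * (X 1 1 * X 2 2 - X 1 2 ^ 2)
    + (l 0 + l 2) * (X 1 1 * X 3 3 - X 1 3 ^ 2) + (l 0 + l 1) * (X 2 2 * X 3 3 - X 2 3 ^ 2))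

/-- Directional derivative of the frame components of the Hessian. -/
def frameDeriv {A : Type*} [CommRing A] (G : Fin 4 → Fin 4 → Fin 4 → A) (ξ : Fin 4 → A)
    (a b : Fin 4) : A := ∑ i, ξ i * G a b i

/-- Second directional derivative of the diagonal frame components of the Hessian. -/
def frameDeriv₂ {A : Type*} [CommRing A] (Z : Fin 4 → Fin 4 → Fin 4 → A) (ξ : Fin 4 → A)
    (a : Fin 4) : A := ∑ i, ∑ j, ξ i * ξ j * Z a i j

/-- The relations satisfied by the data of a solution touched by a test function. -/
structure FrameData.Good (lam R : ℝ) (d : FrameData) : Prop where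
  p_le : ∀ i, |d.p i| ≤ R
  e_le : ∀ a i, |d.e a i| ≤ R
  l_le : ∀ a, |d.l a| ≤ R
  X3_le : ∀ a b c, |d.X3 a b c| ≤ R
  Z_le : ∀ a i j, |d.Z a i j| ≤ R
  l_nonneg : ∀ a, 0 ≤ d.l a
  c_nonneg : ∀ a, 0 ≤ d.c a
  sum_c : ∑ a, d.c a = 1
  c_mul : ∀ a, d.c a * d.l a = d.c 0 * d.l 0
  l_two : R⁻¹ ≤ d.l 2
  l_three : R⁻¹ ≤ d.l 3
  c_big : 1 / 2 ≤ d.c 0 + d.c 1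
  coeff_big : R⁻¹ ≤ gradShift d.l d.p d.e 1 1 + gradShift d.l d.p d.e 3 3
  e_norm : ∑ i, d.e 3 i ^ 2 = 1
  X3_symm : ∀ a b c, d.X3 a b c = d.X3 b a c
  X3_symm' : ∀ a b c, d.X3 a b c = d.X3 a c b
  G_eq : ∀ a b i, d.G a b i = ∑ c, d.X3 a b c * d.e c i
  X3_eq : ∀ a b c, d.X3 a b c = ∑ i, d.e c i * d.G a b i
  Xo_eq : ∀ a i j, d.Xo a i j = ∑ b, ∑ c, d.e b i * d.e c j * d.X3 a b c
  Z_symm : ∀ a i j, d.Z a i j = d.Z a j i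
  star₀ : polarDet (gradShift d.l d.p d.e) (gradShift d.l d.p d.e) = 2 * lam
  star₁ : ∀ a, polarDet (gradShift d.l d.p d.e) (gradShift₁ d.l d.p d.e d.Xo a) = 0
  star₂ : ∀ a, polarDet (gradShift d.l d.p d.e) (gradShift₂ d.l d.p d.e d.G d.Z a)
    + polarDet (gradShift₁ d.l d.p d.e d.Xo a) (gradShift₁ d.l d.p d.e d.Xo a) = 0
  touch₁ : ∀ ξ : Fin 4 → ℝ, ∑ i, ξ i * d.grad i
    = ∑ a, (sigma2Compl d.l a + d.c a ^ 2) * frameDeriv d.G ξ a a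
  touch₂ : ∀ (ξ : Fin 4 → ℝ) (D : Fin 4 → Fin 4 → ℝ), ∑ a, D a a = 0 →
    ∑ i, ∑ j, ξ i * ξ j * d.hess i j
      ≤ ∑ a, (sigma2Compl d.l a + d.c a ^ 2) * frameDeriv₂ d.Z ξ a
        + sigma3Quad d.l (frameDeriv d.G ξ)
        + 4 * ∑ a, ∑ b, D a b * frameDeriv d.G ξ a b * d.c b
        + 2 * ∑ a, ∑ b, d.l a * D a b ^ 2

section RingHom

variable {A B : Type*} [CommRing A] [CommRing B] (φ : A →+* B)

theorem map_polarDet (K M : Fin 4 → Fin 4 → A) :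
    φ (polarDet K M) = polarDet (fun i j => φ (K i j)) (fun i j => φ (M i j)) := by
  simp [polarDet, map_ofNat]

theorem map_gradShift (l p : Fin 4 → A) (e : Fin 4 → Fin 4 → A) (i j : Fin 4) :
    φ (gradShift l p e i j)
      = gradShift (fun a => φ (l a)) (fun a => φ (p a)) (fun a b => φ (e a b)) i j := by
  simp [gradShift]

theorem map_gradShift₁ (l p : Fin 4 → A) (e : Fin 4 → Fin 4 → A)
    (Xo : Fin 4 → Fin 4 → Fin 4 → A) (a i j : Fin 4) :
    φ (gradShift₁ l p e Xo a i j)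
      = gradShift₁ (fun a => φ (l a)) (fun a => φ (p a)) (fun a b => φ (e a b))
        (fun a b c => φ (Xo a b c)) a i j := by
  simp [gradShift₁]

theorem map_gradShift₂ (l p : Fin 4 → A) (e : Fin 4 → Fin 4 → A)
    (G Z : Fin 4 → Fin 4 → Fin 4 → A) (a i j : Fin 4) :
    φ (gradShift₂ l p e G Z a i j)
      = gradShift₂ (fun a => φ (l a)) (fun a => φ (p a)) (fun a b => φ (e a b))
        (fun a b c => φ (G a b c)) (fun a b c => φ (Z a b c)) a i j := by
  simp [gradShift₂, map_ofNat]

theorem map_coeffVec (K : Fin 4 → Fin 4 → A) (m i : Fin 4) :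
    φ (coeffVec K m i) = coeffVec (fun i j => φ (K i j)) m i := by
  fin_cases m <;> fin_cases i <;> simp [coeffVec]

theorem map_sigma2Compl (l : Fin 4 → A) (a : Fin 4) :
    φ (sigma2Compl l a) = sigma2Compl (fun a => φ (l a)) a := by
  fin_cases a <;> simp [sigma2Compl]

theorem map_sigma3Quad (l : Fin 4 → A) (X : Fin 4 → Fin 4 → A) :
    φ (sigma3Quad l X) = sigma3Quad (fun a => φ (l a)) (fun a b => φ (X a b)) := by
  simp [sigma3Quad, map_ofNat]

theorem map_frameDeriv (G : Fin 4 → Fin 4 → Fin 4 → A) (ξ : Fin 4 → A) (a b : Fin 4) :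
    φ (frameDeriv G ξ a b)
      = frameDeriv (fun a b c => φ (G a b c)) (fun i => φ (ξ i)) a b := by
  simp [frameDeriv]

theorem map_frameDeriv₂ (Z : Fin 4 → Fin 4 → Fin 4 → A) (ξ : Fin 4 → A) (a : Fin 4) :
    φ (frameDeriv₂ Z ξ a)
      = frameDeriv₂ (fun a b c => φ (Z a b c)) (fun i => φ (ξ i)) a := by
  simp [frameDeriv₂]

end RingHom

/-- The weights of the rank-one decomposition of the coefficient matrix. -/
def coeffWeight {A : Type*} [CommRing A] (lam b : A) : Fin 4 → A := ![b, b, lam * b, lam * b]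

theorem map_coeffWeight {A B : Type*} [CommRing A] [CommRing B] (φ : A →+* B) (lam b : A)
    (m : Fin 4) : φ (coeffWeight lam b m) = coeffWeight (φ lam) (φ b) m := by
  fin_cases m <;> simp [coeffWeight]

theorem sum_coeffWeight_frameDeriv {A : Type*} [CommRing A] (K M : Fin 4 → Fin 4 → A)
    (lam b : A) (hb : (K 1 1 + K 3 3) * b = 1)
    (hlam : (K 1 1 + K 3 3) * (K 0 0 + K 2 2) = lam + (K 0 1 + K 2 3) ^ 2 + (K 0 3 - K 1 2) ^ 2)
    (hM : ∀ i j, M i j = M j i) :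
    ∑ m, coeffWeight lam b m * ∑ i, ∑ j, coeffVec K m i * coeffVec K m j * M i j
      = polarDet K M := by
  have hb' : K 0 0 + K 2 2 = b * (lam + (K 0 1 + K 2 3) ^ 2 + (K 0 3 - K 1 2) ^ 2) := by
    linear_combination b * hlam - (K 0 0 + K 2 2) * hb
  simp only [polarDet, hb', Fin.sum_univ_four, coeffWeight, coeffVec, Matrix.cons_val]
  rw [hM 1 0, hM 2 0, hM 3 0, hM 2 1, hM 3 1, hM 3 2]
  generalize K 1 1 + K 3 3 = a at *
  generalize K 0 1 + K 2 3 = c at *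
  generalize K 0 3 - K 1 2 = d at *
  linear_combination (a * (M 0 0 + M 2 2) - 2 * c * (M 0 1 + M 2 3) - 2 * d * (M 0 3 - M 1 2)) * hb

theorem second_variation_identity {A : Type*} [CommRing A] (lam h₂ h₃ : A) (l p : Fin 4 → A)
    (e : Fin 4 → Fin 4 → A) (X3 G Xo Z : Fin 4 → Fin 4 → Fin 4 → A) (a : Fin 4)
    (h2 : l 2 * h₂ = 1) (h3 : l 3 * h₃ = 1) (l0 : l 0 = 0) (l1 : l 1 = 0) (la : l a = 0)
    (X0 : ∀ b, X3 a 0 b = 0) (X1 : ∀ b, X3 a 1 b = 0) (Ga : ∀ i, G a a i = 0)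
    (X3_symm : ∀ b c, X3 a b c = X3 a c b)
    (G_eq : ∀ b i, G a b i = ∑ c, X3 a b c * e c i)
    (Xo_eq : ∀ i j, Xo a i j = ∑ b, ∑ c, e b i * e c j * X3 a b c)
    (star₀ : polarDet (gradShift l p e) (gradShift l p e) = 2 * lam)
    (star₁ : polarDet (gradShift l p e) (gradShift₁ l p e Xo a) = 0)
    (star₂ : polarDet (gradShift l p e) (gradShift₂ l p e G Z a)
      + polarDet (gradShift₁ l p e Xo a) (gradShift₁ l p e Xo a) = 0) :
    polarDet (gradShift l p e) (Z a)
      - 2 * h₂ * polarDet (gradShift l p e) (fun i j => G a 2 i * G a 2 j)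
      - 2 * h₃ * polarDet (gradShift l p e) (fun i j => G a 3 i * G a 3 j)
      = 2 * lam * h₂ * h₃ * (X3 a 2 2 * X3 a 3 3 - X3 a 2 3 ^ 2) ∧
    X3 a 2 2 * polarDet (gradShift l p e) (fun i j => e 2 i * e 2 j)
      + X3 a 2 3 * polarDet (gradShift l p e) (fun i j => e 2 i * e 3 j + e 3 i * e 2 j)
      + X3 a 3 3 * polarDet (gradShift l p e) (fun i j => e 3 i * e 3 j) = 0 := by
  have hX0 : ∀ b, X3 a b 0 = 0 := fun b => by rw [X3_symm, X0]
  have hX1 : ∀ b, X3 a b 1 = 0 := fun b => by rw [X3_symm, X1]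
  have hX : ∀ i j, gradShift₁ l p e Xo a i j = X3 a 2 2 * e 2 i * e 2 j
      + X3 a 2 3 * (e 2 i * e 3 j + e 3 i * e 2 j) + X3 a 3 3 * e 3 i * e 3 j := fun i j => by
    simp only [gradShift₁, la, Xo_eq, Fin.sum_univ_four, X0, X1, hX0, hX1, X3_symm 3 2]
    ring
  have hZ : ∀ i j, gradShift₂ l p e G Z a i j = Z a i j := fun i j => by
    simp [gradShift₂, Ga, la]
  have hZ' : gradShift₂ l p e G Z a = Z a := by ext i j; exact hZ i j
  have hK : ∀ i j, gradShift l p e i j = l 2 * e 2 i * e 2 j + l 3 * e 3 i * e 3 j - p i * p j :=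
    fun i j => by simp [gradShift, Fin.sum_univ_four, l0, l1]
  have key := polarDet_rank_two_identity (e 2) (e 3) p (l 2) (l 3) h₂ h₃ _ _ _ h2 h3 _ _ hK hX
  rw [hZ'] at star₂
  have hG2 : (fun i j => G a 2 i * G a 2 j) = fun i j => (X3 a 2 2 * e 2 i + X3 a 2 3 * e 3 i)
      * (X3 a 2 2 * e 2 j + X3 a 2 3 * e 3 j) := by
    ext i j; simp [G_eq, Fin.sum_univ_four, hX0, hX1]
  have hG3 : (fun i j => G a 3 i * G a 3 j) = fun i j => (X3 a 2 3 * e 2 i + X3 a 3 3 * e 3 i)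
      * (X3 a 2 3 * e 2 j + X3 a 3 3 * e 3 j) := by
    ext i j; simp [G_eq, Fin.sum_univ_four, hX0, hX1, X3_symm 3 2]
  refine ⟨?_, ?_⟩
  · rw [hG2, hG3]
    linear_combination key + star₂ - 2 * (X3 a 2 2 * h₂ + X3 a 3 3 * h₃) * star₁
      + h₂ * h₃ * (X3 a 2 2 * X3 a 3 3 - X3 a 2 3 ^ 2) * star₀
  · rw [← star₁]
    simp only [polarDet, hX]
    ring

theorem det_mul_le_polarDet (K : Fin 4 → Fin 4 → ℝ) (u w : Fin 4 → ℝ) (x y z lam : ℝ)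
    (hlam : 0 < lam) (ha : 0 < K 1 1 + K 3 3)
    (hK : polarDet K K = 2 * lam) :
    (x * z - y ^ 2) * polarDet K (fun i j => w i * w j) ≤
      x * (x * polarDet K (fun i j => u i * u j)
        + y * polarDet K (fun i j => u i * w j + w i * u j)
        + z * polarDet K (fun i j => w i * w j)) := by
  have h : x * (x * polarDet K (fun i j => u i * u j)
        + y * polarDet K (fun i j => u i * w j + w i * u j)
        + z * polarDet K (fun i j => w i * w j))
      = (x * z - y ^ 2) * polarDet K (fun i j => w i * w j)
        + polarDet K (fun i j => (x * u i + y * w i) * (x * u j + y * w j)) := by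
    simp only [polarDet]; ring
  rw [h, le_add_iff_nonneg_right,
    ← sum_coeffWeight_frameDeriv K _ lam (K 1 1 + K 3 3)⁻¹ (mul_inv_cancel₀ ha.ne')
      (by simp only [polarDet] at hK; linear_combination hK / 2) (fun i j => by ring)]
  refine Finset.sum_nonneg fun m _ => mul_nonneg ?_ ?_
  · have := inv_pos.2 ha
    fin_cases m <;> simp [coeffWeight] <;> positivity
  · have : ∑ i, ∑ j, coeffVec K m i * coeffVec K m j * ((x * u i + y * w i) * (x * u j + y * w j))
        = (∑ i, coeffVec K m i * (x * u i + y * w i)) ^ 2 := by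
      rw [sq, Finset.sum_mul_sum]
      exact Finset.sum_congr rfl fun i _ => Finset.sum_congr rfl fun j _ => by ring
    rw [this]
    positivity

theorem norm_sq_le_polarDet (K : Fin 4 → Fin 4 → ℝ) (u : Fin 4 → ℝ) (lam : ℝ)
    (hK : polarDet K K = 2 * lam) :
    lam * ∑ i, u i ^ 2
      ≤ (K 1 1 + K 3 3 + (K 0 0 + K 2 2)) * polarDet K (fun i j => u i * u j) := by
  simp only [polarDet, Fin.sum_univ_four] at *
  generalize K 1 1 + K 3 3 = a at *
  generalize K 0 0 + K 2 2 = b at *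
  generalize K 0 1 + K 2 3 = c at *
  generalize K 0 3 - K 1 2 = d at *
  have h : lam = a * b - c ^ 2 - d ^ 2 := by linarith
  have h1 := sq_nonneg (a * u 0 - c * u 1 - d * u 3)
  have h2 := sq_nonneg (a * u 2 - c * u 3 + d * u 1)
  have h3 := sq_nonneg (b * u 1 - c * u 0 + d * u 2)
  have h4 := sq_nonneg (b * u 3 - c * u 2 - d * u 0)
  rw [h]
  linarith

/-- The quantity controlling all the error terms. -/
noncomputable def FrameData.err (d : FrameData) : ℝ :=
  d.l 0 + d.l 1 + ∑ i, |d.grad i|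
    + ∑ m, (|d.c 0 * frameDeriv d.G (coeffVec (gradShift d.l d.p d.e) m) 0 0
        - d.c 1 * frameDeriv d.G (coeffVec (gradShift d.l d.p d.e) m) 1 1|
      + |frameDeriv d.G (coeffVec (gradShift d.l d.p d.e) m) 0 1|)

/-- The part of the second derivative of the barrier along `ξ` with bounded coefficients;
`h₂`, `h₃` stand for the inverses of the large eigenvalues. -/
def barrierMain {A : Type*} [CommRing A] (l c : Fin 4 → A) (G Z : Fin 4 → Fin 4 → Fin 4 → A)
    (h₂ h₃ : A) (ξ : Fin 4 → A) : A :=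
  ∑ a, (sigma2Compl l a + c a ^ 2) * frameDeriv₂ Z ξ a + sigma3Quad l (frameDeriv G ξ)
    - 2 * c 0 ^ 2 * (h₂ * frameDeriv G ξ 0 2 ^ 2 + h₃ * frameDeriv G ξ 0 3 ^ 2)
    - 2 * c 1 ^ 2 * (h₂ * frameDeriv G ξ 1 2 ^ 2 + h₃ * frameDeriv G ξ 1 3 ^ 2)

theorem map_barrierMain {A B : Type*} [CommRing A] [CommRing B] (φ : A →+* B) (l c : Fin 4 → A)
    (G Z : Fin 4 → Fin 4 → Fin 4 → A) (h₂ h₃ : A) (ξ : Fin 4 → A) :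
    φ (barrierMain l c G Z h₂ h₃ ξ) = barrierMain (fun a => φ (l a)) (fun a => φ (c a))
      (fun a b i => φ (G a b i)) (fun a b i => φ (Z a b i)) (φ h₂) (φ h₃) (fun i => φ (ξ i)) := by
  have h : (fun a b => φ (frameDeriv G ξ a b))
      = frameDeriv (fun a b i => φ (G a b i)) (fun i => φ (ξ i)) := by
    ext a b; exact map_frameDeriv φ G ξ a b
  simp only [barrierMain, map_add, map_sub, map_mul, map_sum, map_pow, map_sigma2Compl,
    map_frameDeriv₂, map_sigma3Quad, map_frameDeriv, map_ofNat]

theorem barrierMain_eq {A : Type*} [CommRing A] (l c : Fin 4 → A)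
    (G Z : Fin 4 → Fin 4 → Fin 4 → A) (h₂ h₃ : A) (ξ : Fin 4 → A)
    (h2 : l 2 * h₂ = 1) (h3 : l 3 * h₃ = 1)
    (l0 : l 0 = 0) (l1 : l 1 = 0) (c2 : c 2 = 0) (c3 : c 3 = 0)
    (X00 : frameDeriv G ξ 0 0 = 0) (X01 : frameDeriv G ξ 0 1 = 0) (X11 : frameDeriv G ξ 1 1 = 0) :
    barrierMain l c G Z h₂ h₃ ξ
      = (l 2 * l 3 + c 0 ^ 2) * (frameDeriv₂ Z ξ 0
          - 2 * h₂ * frameDeriv G ξ 0 2 ^ 2 - 2 * h₃ * frameDeriv G ξ 0 3 ^ 2)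
        + (l 2 * l 3 + c 1 ^ 2) * (frameDeriv₂ Z ξ 1
          - 2 * h₂ * frameDeriv G ξ 1 2 ^ 2 - 2 * h₃ * frameDeriv G ξ 1 3 ^ 2) := by
  simp only [barrierMain, Fin.sum_univ_four, sigma2Compl, sigma3Quad, Matrix.cons_val, l0, l1, c2,
    c3, X00, X01, X11]
  linear_combination (2 * l 3 * (frameDeriv G ξ 0 2 ^ 2 + frameDeriv G ξ 1 2 ^ 2)) * h2
    + (2 * l 2 * (frameDeriv G ξ 0 3 ^ 2 + frameDeriv G ξ 1 3 ^ 2)) * h3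

theorem eq_zero_of_coeffVec {A : Type*} [CommRing A] (K : Fin 4 → Fin 4 → A) (w : Fin 4 → A)
    (b : A) (hb : (K 1 1 + K 3 3) * b = 1) (h : ∀ m, ∑ i, coeffVec K m i * w i = 0) (i : Fin 4) :
    w i = 0 := by
  have h0 := h 0
  have h1 := h 1
  have h2 := h 2
  have h3 := h 3
  simp only [Fin.sum_univ_four, coeffVec, Matrix.cons_val, zero_mul, one_mul, zero_add,
    add_zero] at h0 h1 h2 h3
  simp only [h2, h3, mul_zero, add_zero, zero_add] at h0 h1
  fin_cases i
  · change w 0 = 0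
    linear_combination b * h0 - w 0 * hb
  · exact h2
  · change w 2 = 0
    linear_combination b * h1 - w 2 * hb
  · exact h3

theorem sq_frameDeriv {A : Type*} [CommRing A] (G : Fin 4 → Fin 4 → Fin 4 → A) (ξ : Fin 4 → A)
    (a b : Fin 4) :
    frameDeriv G ξ a b ^ 2 = ∑ i, ∑ j, ξ i * ξ j * (G a b i * G a b j) := by
  rw [frameDeriv, sq, Finset.sum_mul_sum]
  exact Finset.sum_congr rfl fun i _ => Finset.sum_congr rfl fun j _ => by ring

theorem sum_coeffWeight_secondVariation {A : Type*} [CommRing A] (K : Fin 4 → Fin 4 → A)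
    (G Z : Fin 4 → Fin 4 → Fin 4 → A) (h₂ h₃ lam b : A) (hb : (K 1 1 + K 3 3) * b = 1)
    (hlam : (K 1 1 + K 3 3) * (K 0 0 + K 2 2) = lam + (K 0 1 + K 2 3) ^ 2 + (K 0 3 - K 1 2) ^ 2)
    (a : Fin 4) (hZ : ∀ i j, Z a i j = Z a j i) :
    ∑ m, coeffWeight lam b m * (frameDeriv₂ Z (coeffVec K m) a
        - 2 * h₂ * frameDeriv G (coeffVec K m) a 2 ^ 2
        - 2 * h₃ * frameDeriv G (coeffVec K m) a 3 ^ 2)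
      = polarDet K (Z a) - 2 * h₂ * polarDet K (fun i j => G a 2 i * G a 2 j)
        - 2 * h₃ * polarDet K (fun i j => G a 3 i * G a 3 j) := by
  rw [← sum_coeffWeight_frameDeriv K (Z a) lam b hb hlam hZ,
    ← sum_coeffWeight_frameDeriv K (fun i j => G a 2 i * G a 2 j) lam b hb hlam
      (fun i j => mul_comm _ _),
    ← sum_coeffWeight_frameDeriv K (fun i j => G a 3 i * G a 3 j) lam b hb hlam
      (fun i j => mul_comm _ _)]
  simp only [sq_frameDeriv, frameDeriv₂, Finset.mul_sum, ← Finset.sum_sub_distrib]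
  refine Finset.sum_congr rfl fun m _ => Finset.sum_congr rfl fun i _ =>
    Finset.sum_congr rfl fun j _ => by ring

set_option maxHeartbeats 4000000 in
theorem FrameData.Good.barrierMain_le (lam R : ℝ) (hlam : 0 < lam) (hR : 0 < R) :
    ∃ C : ℝ, 0 < C ∧ ∀ d : FrameData, d.Good lam R →
      ∑ m, coeffWeight lam (gradShift d.l d.p d.e 1 1 + gradShift d.l d.p d.e 3 3)⁻¹ m
        * barrierMain d.l d.c d.G d.Z (d.l 2)⁻¹ (d.l 3)⁻¹ (coeffVec (gradShift d.l d.p d.e) m)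
      ≤ C * d.err := by
  let ι := {d : FrameData // d.Good lam R}
  have mk : ∀ (f : ι → ℝ) (C : ℝ), (∀ d, |f d| ≤ C) →
      ∃ F : boundedFun ι, ∀ d, F.1 d = f d := fun f C hC => ⟨⟨f, C, hC⟩, fun d => rfl⟩
  choose p hp using fun i => mk (fun d => d.1.p i) R fun d => d.2.p_le i
  choose e he using fun a i => mk (fun d => d.1.e a i) R fun d => d.2.e_le a i
  choose l hl using fun a => mk (fun d => d.1.l a) R fun d => d.2.l_le a
  choose c hc using fun a => mk (fun d => d.1.c a) 1 fun d => by
    rw [abs_of_nonneg (d.2.c_nonneg a), ← d.2.sum_c]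
    exact Finset.single_le_sum (fun a _ => d.2.c_nonneg a) (Finset.mem_univ a)
  choose X3 hX3 using fun a b c => mk (fun d => d.1.X3 a b c) R fun d => d.2.X3_le a b c
  choose Z hZ using fun a i j => mk (fun d => d.1.Z a i j) R fun d => d.2.Z_le a i j
  have inv : ∀ x : ℝ, R⁻¹ ≤ x → |x⁻¹| ≤ R := fun x hx => by
    have := inv_pos.2 hR
    rw [abs_of_pos (inv_pos.2 (this.trans_le hx))]
    exact inv_le_of_inv_le₀ hR hx
  have invR := inv_pos.2 hR
  obtain ⟨h₂, hh₂⟩ := mk (fun d => (d.1.l 2)⁻¹) R fun d => inv _ d.2.l_two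
  obtain ⟨h₃, hh₃⟩ := mk (fun d => (d.1.l 3)⁻¹) R fun d => inv _ d.2.l_three
  obtain ⟨b, hb⟩ := mk (fun d => (gradShift d.1.l d.1.p d.1.e 1 1
    + gradShift d.1.l d.1.p d.1.e 3 3)⁻¹) R fun d => inv _ d.2.coeff_big
  let G : Fin 4 → Fin 4 → Fin 4 → boundedFun ι := fun a b i => ∑ c, X3 a b c * e c i
  let Xo : Fin 4 → Fin 4 → Fin 4 → boundedFun ι :=
    fun a i j => ∑ b, ∑ c, e b i * e c j * X3 a b c
  let K := gradShift l p e
  let E : ι → ℝ := fun d => d.1.err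
  let ev : ι → boundedFun ι →+* ℝ := fun d => (Pi.evalRingHom _ d).comp (boundedFun ι).subtype
  have ext : ∀ {f g : boundedFun ι}, (∀ d, ev d f = ev d g) → f = g := fun h =>
    Subtype.ext (funext h)
  have ev_p : ∀ d i, ev d (p i) = d.1.p i := fun d i => hp i d
  have ev_e : ∀ d a i, ev d (e a i) = d.1.e a i := fun d a i => he a i d
  have ev_l : ∀ d a, ev d (l a) = d.1.l a := fun d a => hl a d
  have ev_c : ∀ d a, ev d (c a) = d.1.c a := fun d a => hc a d
  have ev_X3 : ∀ d a b c, ev d (X3 a b c) = d.1.X3 a b c := fun d a b c => hX3 a b c d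
  have ev_Z : ∀ d a i j, ev d (Z a i j) = d.1.Z a i j := fun d a i j => hZ a i j d
  have ev_h₂ : ∀ d, ev d h₂ = (d.1.l 2)⁻¹ := fun d => hh₂ d
  have ev_h₃ : ∀ d, ev d h₃ = (d.1.l 3)⁻¹ := fun d => hh₃ d
  have ev_b : ∀ d, ev d b = (gradShift d.1.l d.1.p d.1.e 1 1
    + gradShift d.1.l d.1.p d.1.e 3 3)⁻¹ := fun d => hb d
  have ev_G : ∀ d a b i, ev d (G a b i) = d.1.G a b i := fun d a b i => by
    simp [G, d.2.G_eq, ev_X3, ev_e]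
  have ev_Xo : ∀ d a i j, ev d (Xo a i j) = d.1.Xo a i j := fun d a i j => by
    simp [Xo, d.2.Xo_eq, ev_X3, ev_e]
  have ev_K : ∀ d i j, ev d (K i j) = gradShift d.1.l d.1.p d.1.e i j := fun d i j => by
    simp only [K, map_gradShift, ev_l, ev_p, ev_e]
  have ev_ξ : ∀ d m i, ev d (coeffVec K m i) = coeffVec (gradShift d.1.l d.1.p d.1.e) m i :=
    fun d m i => by simp only [map_coeffVec, ev_K]
  have ev_X : ∀ d m a b, ev d (frameDeriv G (coeffVec K m) a b)
      = frameDeriv d.1.G (coeffVec (gradShift d.1.l d.1.p d.1.e) m) a b :=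
    fun d m a b => by simp only [map_frameDeriv, ev_G, ev_ξ]
  obtain ⟨lamB, hlamB⟩ := mk (fun _ => lam) |lam| fun d => le_rfl
  have ev_lam : ∀ d, ev d lamB = lam := fun d => hlamB d
  have pos2 : ∀ d : ι, 0 < d.1.l 2 := fun d => invR.trans_le d.2.l_two
  have pos3 : ∀ d : ι, 0 < d.1.l 3 := fun d => invR.trans_le d.2.l_three
  have posK : ∀ d : ι, 0 < gradShift d.1.l d.1.p d.1.e 1 1 + gradShift d.1.l d.1.p d.1.e 3 3 :=
    fun d => invR.trans_le d.2.coeff_big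
  have h2 : l 2 * h₂ = 1 := ext fun d => by
    rw [map_mul, ev_l, ev_h₂, mul_inv_cancel₀ (pos2 d).ne', map_one]
  have h3 : l 3 * h₃ = 1 := ext fun d => by
    rw [map_mul, ev_l, ev_h₃, mul_inv_cancel₀ (pos3 d).ne', map_one]
  have hKb : (K 1 1 + K 3 3) * b = 1 := ext fun d => by
    rw [map_mul, map_add, ev_K, ev_K, ev_b, mul_inv_cancel₀ (posK d).ne', map_one]
  have X3_symm : ∀ a b c, X3 a b c = X3 b a c := fun a b c => ext fun d => by
    rw [ev_X3, ev_X3, d.2.X3_symm]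
  have X3_symm' : ∀ a b c, X3 a b c = X3 a c b := fun a b c => ext fun d => by
    rw [ev_X3, ev_X3, d.2.X3_symm']
  have X3_eq : ∀ a b c, X3 a b c = ∑ i, e c i * G a b i := fun a b c => ext fun d => by
    simp only [map_sum, map_mul, ev_X3, ev_e, ev_G]
    exact d.2.X3_eq a b c
  have Z_symm : ∀ a i j, Z a i j = Z a j i := fun a i j => ext fun d => by
    rw [ev_Z, ev_Z, d.2.Z_symm]
  have star₀ : polarDet K K = 2 * lamB := ext fun d => by
    simp only [map_polarDet, ev_K, map_mul, map_ofNat, ev_lam]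
    exact d.2.star₀
  have star₁ : ∀ a, polarDet K (gradShift₁ l p e Xo a) = 0 := fun a => ext fun d => by
    simp only [map_polarDet, ev_K, map_gradShift₁, ev_l, ev_p, ev_e, ev_Xo, map_zero]
    exact d.2.star₁ a
  have star₂ : ∀ a, polarDet K (gradShift₂ l p e G Z a)
      + polarDet (gradShift₁ l p e Xo a) (gradShift₁ l p e Xo a) = 0 := fun a => ext fun d => by
    simp only [map_add, map_polarDet, ev_K, map_gradShift₁, map_gradShift₂, ev_l, ev_p, ev_e,
      ev_Xo, ev_G, ev_Z, map_zero]
    exact d.2.star₂ a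
  have sumE : ∀ d : ι, ∀ m, |d.1.c 0 * ev d (frameDeriv G (coeffVec K m) 0 0)
      - d.1.c 1 * ev d (frameDeriv G (coeffVec K m) 1 1)|
      + |ev d (frameDeriv G (coeffVec K m) 0 1)| + d.1.l 0 + d.1.l 1 + ∑ i, |d.1.grad i| ≤ E d := by
    intro d m
    simp only [E, FrameData.err, ← ev_X]
    have := Finset.single_le_sum (f := fun m =>
      |d.1.c 0 * ev d (frameDeriv G (coeffVec K m) 0 0)
      - d.1.c 1 * ev d (frameDeriv G (coeffVec K m) 1 1)|
      + |ev d (frameDeriv G (coeffVec K m) 0 1)|) (fun m _ => by positivity) (Finset.mem_univ m)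
    linarith
  have gradE : ∀ d : ι, ∀ i, |d.1.grad i| ≤ ∑ i, |d.1.grad i| := fun d i =>
    Finset.single_le_sum (f := fun i => |d.1.grad i|) (fun i _ => abs_nonneg _) (Finset.mem_univ i)
  have grad0 : ∀ d : ι, 0 ≤ ∑ i, |d.1.grad i| := fun d =>
    Finset.sum_nonneg fun i _ => abs_nonneg _
  have l0nn : ∀ d : ι, 0 ≤ d.1.l 0 := fun d => d.2.l_nonneg 0
  have l1nn : ∀ d : ι, 0 ≤ d.1.l 1 := fun d => d.2.l_nonneg 1
  have E0 : ∀ d, 0 ≤ E d := fun d => by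
    have := sumE d 0
    have := abs_nonneg (d.1.c 0 * ev d (frameDeriv G (coeffVec K 0) 0 0)
      - d.1.c 1 * ev d (frameDeriv G (coeffVec K 0) 1 1))
    have := abs_nonneg (ev d (frameDeriv G (coeffVec K 0) 0 1))
    linarith [grad0 d, l0nn d, l1nn d]
  have mem_of_le : ∀ f : boundedFun ι, (∀ d, |ev d f| ≤ E d) → f ∈ smallIdeal E := fun f h =>
    mem_smallIdeal.2 ⟨1, fun d => by rw [one_mul]; exact h d⟩
  let q := Ideal.Quotient.mk (smallIdeal E)
  have q_zero : ∀ {f : boundedFun ι}, f ∈ smallIdeal E → q f = 0 := fun h =>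
    Ideal.Quotient.eq_zero_iff_mem.2 h
  have ql0 : q (l 0) = 0 := q_zero <| mem_of_le _ fun d => by
    rw [ev_l, abs_of_nonneg (l0nn d)]
    have := sumE d 0
    have := abs_nonneg (d.1.c 0 * ev d (frameDeriv G (coeffVec K 0) 0 0)
      - d.1.c 1 * ev d (frameDeriv G (coeffVec K 0) 1 1))
    have := abs_nonneg (ev d (frameDeriv G (coeffVec K 0) 0 1))
    linarith [grad0 d, l0nn d, l1nn d]
  have ql1 : q (l 1) = 0 := q_zero <| mem_of_le _ fun d => by
    rw [ev_l, abs_of_nonneg (l1nn d)]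
    have := sumE d 0
    have := abs_nonneg (d.1.c 0 * ev d (frameDeriv G (coeffVec K 0) 0 0)
      - d.1.c 1 * ev d (frameDeriv G (coeffVec K 0) 1 1))
    have := abs_nonneg (ev d (frameDeriv G (coeffVec K 0) 0 1))
    linarith [grad0 d, l0nn d, l1nn d]
  have qX01 : ∀ m, q (frameDeriv G (coeffVec K m) 0 1) = 0 := fun m =>
    q_zero <| mem_of_le _ fun d => by
      have := sumE d m
      have := abs_nonneg (d.1.c 0 * ev d (frameDeriv G (coeffVec K m) 0 0)
        - d.1.c 1 * ev d (frameDeriv G (coeffVec K m) 1 1))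
      linarith [grad0 d, l0nn d, l1nn d]
  have qD : ∀ m, q (c 0 * frameDeriv G (coeffVec K m) 0 0
      - c 1 * frameDeriv G (coeffVec K m) 1 1) = 0 := fun m =>
    q_zero <| mem_of_le _ fun d => by
      rw [map_sub, map_mul, map_mul, ev_c, ev_c]
      have := sumE d m
      have := abs_nonneg (ev d (frameDeriv G (coeffVec K m) 0 1))
      linarith [grad0 d, l0nn d, l1nn d]
  have qc2 : q (c 2) = 0 := by
    have : c 2 = h₂ * (c 0 * l 0) := ext fun d => by
      rw [map_mul, map_mul, ev_c, ev_c, ev_l, ev_h₂, ← d.2.c_mul 2]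
      field_simp [(pos2 d).ne']
    rw [this, map_mul, map_mul, ql0, mul_zero, mul_zero]
  have qc3 : q (c 3) = 0 := by
    have : c 3 = h₃ * (c 0 * l 0) := ext fun d => by
      rw [map_mul, map_mul, ev_c, ev_c, ev_l, ev_h₃, ← d.2.c_mul 3]
      field_simp [(pos3 d).ne']
    rw [this, map_mul, map_mul, ql0, mul_zero, mul_zero]
  have qgrad : ∀ m, q (∑ a, (sigma2Compl l a + c a ^ 2) * frameDeriv G (coeffVec K m) a a) = 0 := by
    intro m
    refine q_zero (mem_smallIdeal.2 ?_)
    choose B hB using fun i => (coeffVec K m i).2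
    refine ⟨∑ i, B i, fun d => ?_⟩
    have h : ev d (∑ a, (sigma2Compl l a + c a ^ 2) * frameDeriv G (coeffVec K m) a a)
        = ∑ i, ev d (coeffVec K m i) * d.1.grad i := by
      simp only [map_sum, map_mul, map_add, map_pow, map_sigma2Compl, ev_l, ev_c, ev_X, ev_ξ]
      exact (d.2.touch₁ _).symm
    change |ev d (∑ a, (sigma2Compl l a + c a ^ 2) * frameDeriv G (coeffVec K m) a a)| ≤ _
    rw [h, Finset.sum_mul]
    refine (Finset.abs_sum_le_sum_abs _ _).trans (Finset.sum_le_sum fun i _ => ?_)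
    rw [abs_mul]
    refine mul_le_mul (hB i d) ?_ (abs_nonneg _) ((abs_nonneg _).trans (hB i d))
    have := sumE d 0
    have := abs_nonneg (d.1.c 0 * ev d (frameDeriv G (coeffVec K 0) 0 0)
      - d.1.c 1 * ev d (frameDeriv G (coeffVec K 0) 1 1))
    have := abs_nonneg (ev d (frameDeriv G (coeffVec K 0) 0 1))
    linarith [gradE d i, l0nn d, l1nn d]
  let br := (sigma2Compl l 0 + c 0 ^ 2) * c 1 + (sigma2Compl l 1 + c 1 ^ 2) * c 0
  have br_pos : ∀ d, R⁻¹ * R⁻¹ / 2 ≤ ev d br := by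
    intro d
    have hc0 := d.2.c_nonneg 0
    have hc1 := d.2.c_nonneg 1
    have hm : R⁻¹ * R⁻¹ ≤ d.1.l 2 * d.1.l 3 :=
      mul_le_mul d.2.l_two d.2.l_three invR.le (pos2 d).le
    have e0 : d.1.l 2 * d.1.l 3 ≤ sigma2Compl d.1.l 0 := by
      simp only [sigma2Compl, Matrix.cons_val]
      nlinarith [mul_nonneg (l1nn d) (pos2 d).le, mul_nonneg (l1nn d) (pos3 d).le]
    have e1 : d.1.l 2 * d.1.l 3 ≤ sigma2Compl d.1.l 1 := by
      simp only [sigma2Compl, Matrix.cons_val]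
      nlinarith [mul_nonneg (l0nn d) (pos2 d).le, mul_nonneg (l0nn d) (pos3 d).le]
    simp only [br, map_add, map_mul, map_pow, map_sigma2Compl, ev_l, ev_c]
    have i0 : R⁻¹ * R⁻¹ * d.1.c 1 ≤ (sigma2Compl d.1.l 0 + d.1.c 0 ^ 2) * d.1.c 1 :=
      mul_le_mul_of_nonneg_right (by nlinarith) hc1
    have i1 : R⁻¹ * R⁻¹ * d.1.c 0 ≤ (sigma2Compl d.1.l 1 + d.1.c 1 ^ 2) * d.1.c 0 :=
      mul_le_mul_of_nonneg_right (by nlinarith) hc0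
    nlinarith [d.2.c_big, mul_pos invR invR]
  have br0 : ∀ d, 0 < ev d br := fun d => lt_of_lt_of_le (by positivity) (br_pos d)
  obtain ⟨bri, hbri⟩ := mk (fun d => (ev d br)⁻¹) (R⁻¹ * R⁻¹ / 2)⁻¹ fun d => by
    rw [abs_of_pos (inv_pos.2 (br0 d))]
    exact inv_anti₀ (by positivity) (br_pos d)
  have hbr : br * bri = 1 := ext fun d => by
    rw [map_mul, show ev d bri = _ from hbri d, mul_inv_cancel₀ (br0 d).ne', map_one]
  have qbr : q br * q bri = 1 := by rw [← map_mul, hbr, map_one]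
  have qX : ∀ m, q (frameDeriv G (coeffVec K m) 0 0) = 0 ∧
      q (frameDeriv G (coeffVec K m) 1 1) = 0 := by
    intro m
    have e1 := qgrad m
    have e2 := qD m
    have e3 := qbr
    simp only [br, Fin.sum_univ_four, map_add, map_sub, map_mul, map_pow, sigma2Compl,
      Matrix.cons_val, ql0, ql1, qc2, qc3] at e1 e2 e3
    generalize q (frameDeriv G (coeffVec K m) 0 0) = x at *
    generalize q (frameDeriv G (coeffVec K m) 1 1) = y at *
    generalize q (l 2) * q (l 3) = g at *
    constructor
    · linear_combination q bri * (q (c 1) * e1 + (g + q (c 1) ^ 2) * e2) - x * e3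
    · linear_combination q bri * (q (c 0) * e1 - (g + q (c 0) ^ 2) * e2) - y * e3
  have qKb : (gradShift (fun a => q (l a)) (fun i => q (p i)) (fun a i => q (e a i)) 1 1
      + gradShift (fun a => q (l a)) (fun i => q (p i)) (fun a i => q (e a i)) 3 3) * q b = 1 := by
    rw [← map_gradShift, ← map_gradShift, ← map_add, ← map_mul]
    exact (congrArg q hKb).trans (map_one q)
  have qvec : ∀ a b', (∀ m, q (frameDeriv G (coeffVec K m) a b') = 0) →
      ∀ i, q (G a b' i) = 0 := by
    intro a b' h
    refine eq_zero_of_coeffVec _ _ _ qKb fun m => ?_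
    have := h m
    simp only [map_frameDeriv, map_coeffVec, K, map_gradShift] at this
    exact this
  have qG00 := qvec 0 0 fun m => (qX m).1
  have qG11 := qvec 1 1 fun m => (qX m).2
  have qG01 := qvec 0 1 qX01
  have qG10 : ∀ i, q (G 1 0 i) = 0 := fun i => by
    rw [← qG01 i]
    simp only [G, X3_symm 1 0]
  have qG : ∀ a : Fin 4, a = 0 ∨ a = 1 → ∀ i, q (G a 0 i) = 0 ∧ q (G a 1 i) = 0 := by
    rintro a (rfl | rfl) i
    exacts [⟨qG00 i, qG01 i⟩, ⟨qG10 i, qG11 i⟩]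
  have qX3 : ∀ a b', (∀ i, q (G a b' i) = 0) → ∀ k, q (X3 a b' k) = 0 := fun a b' h k => by
    simp only [X3_eq a b' k, map_sum, map_mul, h, mul_zero, Finset.sum_const_zero]
  let N : Fin 4 → boundedFun ι := fun a => polarDet K (Z a)
    - 2 * h₂ * polarDet K (fun i j => G a 2 i * G a 2 j)
    - 2 * h₃ * polarDet K (fun i j => G a 3 i * G a 3 j)
  let M : Fin 4 → boundedFun ι := fun a =>
    2 * lamB * h₂ * h₃ * (X3 a 2 2 * X3 a 3 3 - X3 a 2 3 ^ 2)
  let Q : Fin 4 → boundedFun ι := fun a => X3 a 2 2 * polarDet K (fun i j => e 2 i * e 2 j)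
      + X3 a 2 3 * polarDet K (fun i j => e 2 i * e 3 j + e 3 i * e 2 j)
      + X3 a 3 3 * polarDet K (fun i j => e 3 i * e 3 j)
  have qN : ∀ a : Fin 4, a = 0 ∨ a = 1 → q (N a) = q (M a) ∧ q (Q a) = 0 := by
    intro a ha
    have hG := qG a ha
    have key := second_variation_identity (q lamB) (q h₂) (q h₃) (fun a => q (l a))
      (fun i => q (p i)) (fun a i => q (e a i)) (fun a b c => q (X3 a b c))
      (fun a b i => q (G a b i)) (fun a i j => q (Xo a i j)) (fun a i j => q (Z a i j)) a
      (by rw [← map_mul, h2, map_one]) (by rw [← map_mul, h3, map_one]) ql0 ql1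
      (by rcases ha with rfl | rfl <;> assumption)
      (fun k => qX3 a 0 (fun i => (hG i).1) k) (fun k => qX3 a 1 (fun i => (hG i).2) k)
      (by rcases ha with rfl | rfl <;> assumption)
      (fun b c => by rw [X3_symm'])
      (fun b i => by simp only [G, map_sum, map_mul])
      (fun i j => by simp only [Xo, map_sum, map_mul])
      (by simpa only [map_polarDet, K, map_gradShift, map_mul, map_ofNat] using congrArg q star₀)
      (by simpa only [map_polarDet, K, map_gradShift, map_gradShift₁, map_zero]
        using congrArg q (star₁ a))
      (by simpa only [map_add, map_polarDet, K, map_gradShift, map_gradShift₁, map_gradShift₂,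
        map_zero] using congrArg q (star₂ a))
    simpa only [N, M, Q, K, map_add, map_sub, map_mul, map_pow, map_polarDet, map_gradShift,
      map_ofNat] using key
  have star_d : ∀ d : ι, polarDet (gradShift d.1.l d.1.p d.1.e) (gradShift d.1.l d.1.p d.1.e)
      = 2 * lam := fun d => d.2.star₀
  obtain ⟨B, hB⟩ := (K 1 1 + K 3 3 + (K 0 0 + K 2 2)).2
  let P := polarDet K (fun i j => e 3 i * e 3 j)
  have evP : ∀ d, ev d P = polarDet (gradShift d.1.l d.1.p d.1.e)
      (fun i j => d.1.e 3 i * d.1.e 3 j) := fun d => by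
    simp only [P, map_polarDet, ev_K, map_mul, ev_e]
  have P_pos : ∀ d, 0 < ev d P ∧ lam ≤ B * ev d P := by
    intro d
    have h1 := norm_sq_le_polarDet _ (d.1.e 3) lam (star_d d)
    rw [d.2.e_norm, mul_one, ← evP] at h1
    have h2 : ev d (K 1 1 + K 3 3 + (K 0 0 + K 2 2)) ≤ B := (le_abs_self _).trans (hB d)
    simp only [map_add, ev_K] at h2
    have h3 := star_d d
    have h4 := posK d
    simp only [polarDet] at h3
    generalize gradShift d.1.l d.1.p d.1.e 1 1 + gradShift d.1.l d.1.p d.1.e 3 3 = x at *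
    generalize gradShift d.1.l d.1.p d.1.e 0 0 + gradShift d.1.l d.1.p d.1.e 2 2 = y at *
    have h5 : 0 < y := by
      by_contra hy
      nlinarith [sq_nonneg (gradShift d.1.l d.1.p d.1.e 0 1 + gradShift d.1.l d.1.p d.1.e 2 3),
        sq_nonneg (gradShift d.1.l d.1.p d.1.e 0 3 - gradShift d.1.l d.1.p d.1.e 1 2)]
    have h6 : 0 < ev d P := by
      by_contra hP
      nlinarith
    exact ⟨h6, h1.trans (mul_le_mul_of_nonneg_right h2 h6.le)⟩
  obtain ⟨Pi, hPi⟩ := mk (fun d => (ev d P)⁻¹) (B / lam) fun d => by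
    rw [abs_of_pos (inv_pos.2 (P_pos d).1), inv_eq_one_div, div_le_div_iff₀ (P_pos d).1 hlam]
    linarith [(P_pos d).2]
  have evPi : ∀ d, ev d Pi = (ev d P)⁻¹ := hPi
  let S : Fin 4 → boundedFun ι := fun a => N a - M a + 2 * lamB * h₂ * h₃ * Pi * X3 a 2 2 * Q a
  have qS : ∀ a : Fin 4, a = 0 ∨ a = 1 → q (S a) = 0 := fun a ha => by
    simp only [S, map_add, map_sub, map_mul, (qN a ha).1, (qN a ha).2, sub_self, mul_zero, add_zero]
  have NS : ∀ d a, ev d (N a) ≤ ev d (S a) := by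
    intro d a
    have h1 := det_mul_le_polarDet (gradShift d.1.l d.1.p d.1.e) (d.1.e 2) (d.1.e 3)
      (d.1.X3 a 2 2) (d.1.X3 a 2 3) (d.1.X3 a 3 3) lam hlam (posK d) (star_d d)
    have h2 : ev d (Q a) = d.1.X3 a 2 2 * polarDet (gradShift d.1.l d.1.p d.1.e)
          (fun i j => d.1.e 2 i * d.1.e 2 j)
        + d.1.X3 a 2 3 * polarDet (gradShift d.1.l d.1.p d.1.e)
          (fun i j => d.1.e 2 i * d.1.e 3 j + d.1.e 3 i * d.1.e 2 j)
        + d.1.X3 a 3 3 * polarDet (gradShift d.1.l d.1.p d.1.e)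
          (fun i j => d.1.e 3 i * d.1.e 3 j) := by
      simp only [Q, map_add, map_mul, map_polarDet, ev_K, ev_X3, ev_e]
    rw [← h2, ← evP, ← le_div_iff₀ (P_pos d).1] at h1
    have h3 : 0 ≤ 2 * lam * (d.1.l 2)⁻¹ * (d.1.l 3)⁻¹ := by
      have := pos2 d
      have := pos3 d
      positivity
    have h4 := mul_le_mul_of_nonneg_left h1 h3
    have h5 : ev d (S a) = ev d (N a) - ev d (M a)
        + 2 * lam * (d.1.l 2)⁻¹ * (d.1.l 3)⁻¹ * (d.1.X3 a 2 2 * ev d (Q a) / ev d P) := by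
      simp only [S, map_add, map_sub, map_mul, ev_lam, ev_h₂, ev_h₃, ev_X3, evPi, map_ofNat]
      ring
    have h6 : ev d (M a) = 2 * lam * (d.1.l 2)⁻¹ * (d.1.l 3)⁻¹
        * (d.1.X3 a 2 2 * d.1.X3 a 3 3 - d.1.X3 a 2 3 ^ 2) := by
      simp only [M, map_sub, map_mul, map_pow, ev_lam, ev_h₂, ev_h₃, ev_X3, map_ofNat]
    rw [h5, h6]
    linarith
  let T : boundedFun ι := ∑ m, coeffWeight lamB b m * barrierMain l c G Z h₂ h₃ (coeffVec K m)
  have hKlam : (K 1 1 + K 3 3) * (K 0 0 + K 2 2)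
      = lamB + (K 0 1 + K 2 3) ^ 2 + (K 0 3 - K 1 2) ^ 2 := ext fun d => by
    have := star_d d
    simp only [polarDet] at this
    simp only [map_add, map_sub, map_mul, map_pow, ev_K, ev_lam]
    linear_combination this / 2
  let W : Fin 4 → boundedFun ι := fun a => l 2 * l 3 + c a ^ 2
  have qT : q (T - (W 0 * N 0 + W 1 * N 1)) = 0 := by
    have e1 : ∀ m, q (barrierMain l c G Z h₂ h₃ (coeffVec K m))
        = q (W 0 * (frameDeriv₂ Z (coeffVec K m) 0
          - 2 * h₂ * frameDeriv G (coeffVec K m) 0 2 ^ 2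
          - 2 * h₃ * frameDeriv G (coeffVec K m) 0 3 ^ 2)
        + W 1 * (frameDeriv₂ Z (coeffVec K m) 1
          - 2 * h₂ * frameDeriv G (coeffVec K m) 1 2 ^ 2
          - 2 * h₃ * frameDeriv G (coeffVec K m) 1 3 ^ 2)) := by
      intro m
      rw [map_barrierMain, barrierMain_eq _ _ _ _ _ _ _ (by rw [← map_mul, h2, map_one])
        (by rw [← map_mul, h3, map_one]) ql0 ql1 qc2 qc3
        (by rw [← map_frameDeriv]; exact (qX m).1) (by rw [← map_frameDeriv]; exact qX01 m)
        (by rw [← map_frameDeriv]; exact (qX m).2)]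
      simp only [W, map_add, map_sub, map_mul, map_pow, map_frameDeriv, map_frameDeriv₂, map_ofNat]
    have e2 := sum_coeffWeight_secondVariation K G Z h₂ h₃ lamB b hKb hKlam
    have e3 : W 0 * N 0 + W 1 * N 1 = ∑ m, coeffWeight lamB b m *
        (W 0 * (frameDeriv₂ Z (coeffVec K m) 0
          - 2 * h₂ * frameDeriv G (coeffVec K m) 0 2 ^ 2
          - 2 * h₃ * frameDeriv G (coeffVec K m) 0 3 ^ 2)
        + W 1 * (frameDeriv₂ Z (coeffVec K m) 1
          - 2 * h₂ * frameDeriv G (coeffVec K m) 1 2 ^ 2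
          - 2 * h₃ * frameDeriv G (coeffVec K m) 1 3 ^ 2)) := by
      simp only [N]
      rw [← e2 0 (Z_symm 0), ← e2 1 (Z_symm 1), Finset.mul_sum, Finset.mul_sum,
        ← Finset.sum_add_distrib]
      exact Finset.sum_congr rfl fun m _ => by ring
    rw [e3, map_sub, sub_eq_zero]
    simp only [T, map_sum, map_mul, e1]
  let U : boundedFun ι := T - (W 0 * N 0 + W 1 * N 1) + (W 0 * S 0 + W 1 * S 1)
  have qU : q U = 0 := by
    rw [map_add, qT, map_add, map_mul, map_mul, qS 0 (Or.inl rfl), qS 1 (Or.inr rfl)]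
    ring
  obtain ⟨C, hC⟩ := mem_smallIdeal.1 (Ideal.Quotient.eq_zero_iff_mem.1 qU)
  refine ⟨max C 1, lt_max_of_lt_right one_pos, fun d hd => ?_⟩
  let d' : ι := ⟨d, hd⟩
  have hT : ev d' T = ∑ m, coeffWeight lam (gradShift d.l d.p d.e 1 1 + gradShift d.l d.p d.e 3 3)⁻¹ m
      * barrierMain d.l d.c d.G d.Z (d.l 2)⁻¹ (d.l 3)⁻¹ (coeffVec (gradShift d.l d.p d.e) m) := by
    simp only [T, map_sum, map_mul, map_coeffWeight, map_barrierMain, ev_lam, ev_b, ev_l, ev_c,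
      ev_G, ev_Z, ev_h₂, ev_h₃, ev_ξ, d']
  rw [← hT]
  have hW : ∀ a, 0 ≤ ev d' (W a) := fun a => by
    have := pos2 d'
    have := pos3 d'
    simp only [W, map_add, map_mul, map_pow, ev_l, ev_c]
    positivity
  have hU : ev d' T ≤ ev d' U := by
    simp only [U, map_add, map_sub, map_mul]
    nlinarith [mul_le_mul_of_nonneg_left (NS d' 0) (hW 0),
      mul_le_mul_of_nonneg_left (NS d' 1) (hW 1)]
  refine hU.trans ((le_abs_self _).trans ((hC d').trans ?_))
  exact mul_le_mul_of_nonneg_right (le_max_left _ _) (E0 d')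


theorem FrameData.Good.touch_le {lam R : ℝ} {d : FrameData} (hd : d.Good lam R) (hR : 0 < R)
    (ξ : Fin 4 → ℝ) {s : ℝ} (hs : 0 ≤ s) (hs' : s * (d.l 0 + d.l 1) ≤ 1) :
    ∑ i, ∑ j, ξ i * ξ j * d.hess i j
      ≤ barrierMain d.l d.c d.G d.Z (d.l 2)⁻¹ (d.l 3)⁻¹ ξ
        - s / 4 * ((d.c 0 * frameDeriv d.G ξ 0 0 - d.c 1 * frameDeriv d.G ξ 1 1) ^ 2
          + frameDeriv d.G ξ 0 1 ^ 2) := by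
  have hX : ∀ a b, frameDeriv d.G ξ a b = frameDeriv d.G ξ b a := fun a b => by
    simp only [frameDeriv, hd.G_eq, hd.X3_symm a b]
  have invR := inv_pos.2 hR
  have pos2 := invR.trans_le hd.l_two
  have pos3 := invR.trans_le hd.l_three
  have n0 := hd.l_nonneg 0
  have n1 := hd.l_nonneg 1
  set X := frameDeriv d.G ξ with hXdef
  set θ := -s * (d.c 0 * X 0 0 - d.c 1 * X 1 1) with hθ
  have key := hd.touch₂ ξ
    ![![θ, -(d.c 1 * s * X 0 1), 0, 0], ![-(d.c 0 * s * X 0 1), -θ, 0, 0],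
      ![-(d.c 0 * X 0 2 * (d.l 2)⁻¹), -(d.c 1 * X 1 2 * (d.l 2)⁻¹), 0, 0],
      ![-(d.c 0 * X 0 3 * (d.l 3)⁻¹), -(d.c 1 * X 1 3 * (d.l 3)⁻¹), 0, 0]]
    (by simp [Fin.sum_univ_four])
  refine key.trans ?_
  simp only [barrierMain, ← hXdef]
  generalize ∑ a, (sigma2Compl d.l a + d.c a ^ 2) * frameDeriv₂ d.Z ξ a = Y
  generalize sigma3Quad d.l X = Q
  simp only [Fin.sum_univ_four, Matrix.cons_val, hX 1 0, hX 2 0, hX 2 1, hX 3 0, hX 3 1]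
  have e2 : d.l 2 * (d.l 2)⁻¹ = 1 := mul_inv_cancel₀ pos2.ne'
  have e3 : d.l 3 * (d.l 3)⁻¹ = 1 := mul_inv_cancel₀ pos3.ne'
  generalize (d.l 2)⁻¹ = h₂ at *
  generalize (d.l 3)⁻¹ = h₃ at *
  have hc : 1 / 8 ≤ d.c 0 ^ 2 + d.c 1 ^ 2 := by
    nlinarith [hd.c_big, sq_nonneg (d.c 0 - d.c 1)]
  have s0 : s * d.l 0 ≤ 1 := by nlinarith
  have s1 : s * d.l 1 ≤ 1 := by nlinarith
  set D := d.c 0 * X 0 0 - d.c 1 * X 1 1 with hD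
  have i1 : 2 * θ ^ 2 * (d.l 0 + d.l 1) ≤ 2 * s * D ^ 2 := by
    have : 0 ≤ 2 * s * D ^ 2 := by positivity
    rw [hθ]
    nlinarith [mul_le_mul_of_nonneg_left hs' this]
  have i2 : 2 * s ^ 2 * X 0 1 ^ 2 * (d.l 1 * d.c 0 ^ 2 + d.l 0 * d.c 1 ^ 2)
      ≤ 2 * s * X 0 1 ^ 2 * (d.c 0 ^ 2 + d.c 1 ^ 2) := by
    have h0 : 0 ≤ 2 * s * X 0 1 ^ 2 * d.c 0 ^ 2 := by positivity
    have h1 : 0 ≤ 2 * s * X 0 1 ^ 2 * d.c 1 ^ 2 := by positivity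
    nlinarith [mul_le_mul_of_nonneg_left s1 h0, mul_le_mul_of_nonneg_left s0 h1]
  have i3 : s * X 0 1 ^ 2 / 4 ≤ 2 * s * X 0 1 ^ 2 * (d.c 0 ^ 2 + d.c 1 ^ 2) := by
    have : 0 ≤ 2 * s * X 0 1 ^ 2 := by positivity
    nlinarith [mul_le_mul_of_nonneg_left hc this]
  have i4 : 0 ≤ s * D ^ 2 := by positivity
  have hDθ : θ = -s * D := hθ
  have e : 4 * θ * D = - 4 * s * D ^ 2 := by rw [hDθ]; ring
  have k2 := congrArg (fun t => t * h₂ * ((d.c 0 * X 0 2) ^ 2 + (d.c 1 * X 1 2) ^ 2)) e2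
  have k3 := congrArg (fun t => t * h₃ * ((d.c 0 * X 0 3) ^ 2 + (d.c 1 * X 1 3) ^ 2)) e3
  have e' : 4 * θ * D = 4 * (θ * X 0 0 * d.c 0) - 4 * (θ * X 1 1 * d.c 1) := by rw [hD]; ring
  clear_value D θ X
  linarith

theorem FrameData.Good.coeff_le {lam R : ℝ} {d : FrameData} (hd : d.Good lam R) (hR : 0 < R) :
    gradShift d.l d.p d.e 1 1 + gradShift d.l d.p d.e 3 3 ≤ 8 * R ^ 3 := by
  have h : ∀ i, gradShift d.l d.p d.e i i ≤ 4 * R ^ 3 := by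
    intro i
    have hs : ∑ a, d.l a * d.e a i * d.e a i ≤ ∑ _a : Fin 4, R ^ 3 := by
      refine Finset.sum_le_sum fun a _ => ?_
      have h1 := (abs_le.1 (hd.l_le a)).2
      have h2 : d.e a i ^ 2 ≤ R ^ 2 := sq_le_sq.2 ((hd.e_le a i).trans (le_abs_self R))
      nlinarith [sq_nonneg (d.e a i), hd.l_nonneg a]
    simp only [gradShift]
    simp at hs
    nlinarith [sq_nonneg (d.p i)]
  linarith [h 1, h 3]

theorem FrameData.Good.estimate (lam R : ℝ) (hlam : 0 < lam) (hR : 0 < R) :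
    ∃ C : ℝ, 0 < C ∧ ∀ d : FrameData, d.Good lam R →
      ∑ m, coeffWeight lam (gradShift d.l d.p d.e 1 1 + gradShift d.l d.p d.e 3 3)⁻¹ m
        * ∑ i, ∑ j, coeffVec (gradShift d.l d.p d.e) m i * coeffVec (gradShift d.l d.p d.e) m j
          * d.hess i j
      ≤ C * (d.l 0 + d.l 1 + ∑ i, |d.grad i|) := by
  obtain ⟨C, hC, hmain⟩ := FrameData.Good.barrierMain_le lam R hlam hR
  set κ₀ := min 1 lam * (8 * R ^ 3)⁻¹ with hκ₀
  have hκ₀pos : 0 < κ₀ := mul_pos (lt_min one_pos hlam) (by positivity)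
  refine ⟨C + 8 * (C ^ 2 / κ₀), by positivity, fun d hd => ?_⟩
  have main := hmain d hd
  have n0 := hd.l_nonneg 0
  have n1 := hd.l_nonneg 1
  have invR := inv_pos.2 hR
  have hb : (8 * R ^ 3)⁻¹ ≤ (gradShift d.l d.p d.e 1 1 + gradShift d.l d.p d.e 3 3)⁻¹ :=
    inv_anti₀ (invR.trans_le hd.coeff_big) (hd.coeff_le hR)
  set b := (gradShift d.l d.p d.e 1 1 + gradShift d.l d.p d.e 3 3)⁻¹ with hbdef
  set ξ := coeffVec (gradShift d.l d.p d.e) with hξ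
  have hκ : ∀ m, κ₀ ≤ coeffWeight lam b m := by
    have h1 : κ₀ ≤ 1 * b := mul_le_mul (min_le_left _ _) hb (by positivity) one_pos.le
    have h2 : κ₀ ≤ lam * b := mul_le_mul (min_le_right _ _) hb (by positivity) hlam.le
    rw [one_mul] at h1
    intro m
    fin_cases m <;> simpa [coeffWeight]
  set W := ∑ m, coeffWeight lam b m * ∑ i, ∑ j, ξ m i * ξ m j * d.hess i j with hW
  set Dm : Fin 4 → ℝ := fun m =>
    d.c 0 * frameDeriv d.G (ξ m) 0 0 - d.c 1 * frameDeriv d.G (ξ m) 1 1 with hDm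
  set Xm : Fin 4 → ℝ := fun m => frameDeriv d.G (ξ m) 0 1 with hXm
  have young : ∀ s : ℝ, 0 < s → ∀ t : ℝ, C * |t| - κ₀ * (s / 4) * t ^ 2 ≤ C ^ 2 / κ₀ / s := by
    intro s hs t
    rw [← sq_abs t, div_div, le_div_iff₀ (by positivity)]
    nlinarith [sq_nonneg (C - κ₀ * s / 2 * |t|)]
  have bound : ∀ s : ℝ, 0 < s → s * (d.l 0 + d.l 1) ≤ 1 →
      W ≤ C * (d.l 0 + d.l 1 + ∑ i, |d.grad i|) + 8 * (C ^ 2 / κ₀ / s) := by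
    intro s hs hs'
    have h1 : W ≤ ∑ m, coeffWeight lam b m * barrierMain d.l d.c d.G d.Z (d.l 2)⁻¹ (d.l 3)⁻¹ (ξ m)
        - ∑ m, κ₀ * (s / 4 * (Dm m ^ 2 + Xm m ^ 2)) := by
      rw [← Finset.sum_sub_distrib]
      refine Finset.sum_le_sum fun m _ => ?_
      have h2 := mul_le_mul_of_nonneg_left (hd.touch_le hR (ξ m) hs.le hs')
        (hκ₀pos.le.trans (hκ m))
      have h3 : 0 ≤ s / 4 * (Dm m ^ 2 + Xm m ^ 2) := by positivity
      have h4 := mul_le_mul_of_nonneg_right (hκ m) h3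
      rw [mul_sub] at h2
      linarith
    have h2 : ∀ m, C * (|Dm m| + |Xm m|) - κ₀ * (s / 4 * (Dm m ^ 2 + Xm m ^ 2))
        ≤ 2 * (C ^ 2 / κ₀ / s) := fun m => by
      have := young s hs (Dm m)
      have := young s hs (Xm m)
      linarith
    have h3 : ∑ m, C * (|Dm m| + |Xm m|) - ∑ m, κ₀ * (s / 4 * (Dm m ^ 2 + Xm m ^ 2))
        ≤ ∑ _m : Fin 4, 2 * (C ^ 2 / κ₀ / s) := by
      rw [← Finset.sum_sub_distrib]
      exact Finset.sum_le_sum fun m _ => h2 m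
    have h4 : C * d.err = C * (d.l 0 + d.l 1 + ∑ i, |d.grad i|)
        + ∑ m, C * (|Dm m| + |Xm m|) := by
      rw [FrameData.err, mul_add, Finset.mul_sum]
    rw [Finset.sum_const, Finset.card_univ, Fintype.card_fin, nsmul_eq_mul] at h3
    push_cast at h3
    linarith
  have hg : 0 ≤ ∑ i, |d.grad i| := Finset.sum_nonneg fun i _ => abs_nonneg _
  rcases (add_nonneg n0 n1).eq_or_lt with h | h
  · rw [← h] at bound ⊢
    have hlim : Filter.Tendsto (fun s : ℝ => C * (0 + ∑ i, |d.grad i|) + 8 * (C ^ 2 / κ₀ / s))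
        Filter.atTop (nhds (C * (0 + ∑ i, |d.grad i|) + 8 * 0)) :=
      (tendsto_const_nhds.div_atTop Filter.tendsto_id).const_mul 8 |>.const_add _
    have := ge_of_tendsto hlim ((Filter.eventually_gt_atTop 0).mono fun s hs =>
      bound s hs (by simp))
    have h5 : 0 ≤ C ^ 2 / κ₀ := by positivity
    nlinarith
  · have := bound (d.l 0 + d.l 1)⁻¹ (inv_pos.2 h) (inv_mul_cancel₀ h.ne').le
    rw [div_inv_eq_mul] at this
    have h5 : 0 ≤ C ^ 2 / κ₀ := by positivity
    nlinarith

/-- `w` has the second order Taylor expansion `a + b t + c t²` at `0`. -/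
def HasJet (w : ℝ → ℝ) (a b c : ℝ) : Prop :=
  (fun t => w t - (a + b * t + c * t ^ 2)) =o[nhds 0] fun t : ℝ => t ^ 2

namespace HasJet

variable {w w' : ℝ → ℝ} {a b c a' b' c' : ℝ}

theorem const (k : ℝ) : HasJet (fun _ => k) k 0 0 := by
  simp only [HasJet, zero_mul, add_zero, sub_self]
  exact Asymptotics.isLittleO_zero _ _

theorem id : HasJet (fun t => t) 0 1 0 := by
  simp only [HasJet, zero_mul, add_zero, one_mul, zero_add, sub_self]
  exact Asymptotics.isLittleO_zero _ _

theorem add (h : HasJet w a b c) (h' : HasJet w' a' b' c') :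
    HasJet (fun t => w t + w' t) (a + a') (b + b') (c + c') := by
  refine (Asymptotics.IsLittleO.add h h').congr_left fun t => ?_
  ring

theorem const_mul (k : ℝ) (h : HasJet w a b c) :
    HasJet (fun t => k * w t) (k * a) (k * b) (k * c) := by
  refine (Asymptotics.IsLittleO.const_mul_left h k).congr_left fun t => ?_
  ring

theorem sub (h : HasJet w a b c) (h' : HasJet w' a' b' c') :
    HasJet (fun t => w t - w' t) (a - a') (b - b') (c - c') := by
  refine (Asymptotics.IsLittleO.sub h h').congr_left fun t => ?_
  ring

theorem tendsto (h : HasJet w a b c) : Filter.Tendsto w (nhds 0) (nhds a) := by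
  have h1 : Filter.Tendsto (fun t : ℝ => t ^ 2) (nhds 0) (nhds 0) := by
    simpa using (continuous_pow 2).tendsto (0 : ℝ)
  have h2 : Filter.Tendsto (fun t : ℝ => a + b * t + c * t ^ 2) (nhds 0) (nhds a) := by
    have : Continuous fun t : ℝ => a + b * t + c * t ^ 2 := by fun_prop
    simpa using this.tendsto 0
  simpa using (h.trans_tendsto h1).add h2

theorem mul (h : HasJet w a b c) (h' : HasJet w' a' b' c') :
    HasJet (fun t => w t * w' t) (a * a') (a * b' + b * a') (a * c' + b * b' + c * a') := by
  have h1 : (fun t => (w t - (a + b * t + c * t ^ 2)) * w' t) =o[nhds 0] fun t : ℝ => t ^ 2 := by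
    simpa using h.mul_isBigO (h'.tendsto.isBigO_one ℝ)
  have h2 : (fun t => (w' t - (a' + b' * t + c' * t ^ 2)) * (a + b * t + c * t ^ 2))
      =o[nhds 0] fun t : ℝ => t ^ 2 := by
    have : Filter.Tendsto (fun t : ℝ => a + b * t + c * t ^ 2) (nhds 0) (nhds (a + b * 0 + c * 0 ^ 2)) := by
      have : Continuous fun t : ℝ => a + b * t + c * t ^ 2 := by fun_prop
      exact this.tendsto 0
    simpa using h'.mul_isBigO (this.isBigO_one ℝ)
  have h3 : (fun t : ℝ => ((b * c' + c * b') + c * c' * t) * t * t ^ 2)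
      =o[nhds 0] fun t : ℝ => t ^ 2 := by
    have h4 : (fun t : ℝ => ((b * c' + c * b') + c * c' * t) * t) =o[nhds 0] fun _ : ℝ => (1 : ℝ) := by
      rw [Asymptotics.isLittleO_one_iff]
      have : Continuous fun t : ℝ => ((b * c' + c * b') + c * c' * t) * t := by fun_prop
      simpa using this.tendsto 0
    simpa using h4.mul_isBigO (Asymptotics.isBigO_refl (fun t : ℝ => t ^ 2) (nhds 0))
  refine ((h1.add h2).add h3).congr_left fun t => ?_
  ring

theorem sum {ι : Type*} (s : Finset ι) {w : ι → ℝ → ℝ} {a b c : ι → ℝ}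
    (h : ∀ i ∈ s, HasJet (w i) (a i) (b i) (c i)) :
    HasJet (fun t => ∑ i ∈ s, w i t) (∑ i ∈ s, a i) (∑ i ∈ s, b i) (∑ i ∈ s, c i) := by
  refine (Asymptotics.IsLittleO.sum h).congr_left fun t => ?_
  simp only [Finset.sum_apply, Finset.sum_sub_distrib, Finset.sum_add_distrib, Finset.sum_mul]

theorem congr (h : HasJet w a b c) (ha : a = a') (hb : b = b') (hc : c = c') :
    HasJet w a' b' c' := by
  subst ha hb hc
  exact h

theorem congr_of_eventuallyEq (h : HasJet w a b c) (hw : ∀ᶠ t in nhds 0, w' t = w t) :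
    HasJet w' a b c :=
  Asymptotics.IsLittleO.congr' h (hw.mono fun t ht => by simp only [ht]) Filter.EventuallyEq.rfl

theorem nonneg (h : HasJet w 0 b c) (hw : ∀ᶠ t in nhds 0, 0 ≤ w t) : b = 0 ∧ 0 ≤ c := by
  have key : ∀ ε > 0, ∀ᶠ t in nhds (0 : ℝ), 0 ≤ b * t + (c + ε) * t ^ 2 := by
    intro ε hε
    filter_upwards [hw, h.def hε] with t h1 h2
    rw [Real.norm_eq_abs, Real.norm_eq_abs, abs_of_nonneg (sq_nonneg t)] at h2
    linarith [(abs_le.1 h2).2]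
  have hb : b = 0 := by
    obtain ⟨δ, hδ, hk⟩ := Metric.eventually_nhds_iff.1 (key 1 one_pos)
    have hd : ∀ s : ℝ, 0 < s → s < δ → |b| ≤ |c + 1| * s := by
      intro s hs hsd
      have h1 := hk (y := s) (by simpa [abs_of_pos hs])
      have h2 := hk (y := -s) (by simpa [abs_of_pos hs])
      have h3 : (c + 1) * s ≤ |c + 1| * s := mul_le_mul_of_nonneg_right (le_abs_self _) hs.le
      rw [abs_le]
      constructor <;> nlinarith
    have hlim : Filter.Tendsto (fun s : ℝ => |c + 1| * s) (nhdsWithin 0 (Set.Ioi 0)) (nhds 0) := by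
      have : Continuous fun s : ℝ => |c + 1| * s := by fun_prop
      simpa using (this.tendsto 0).mono_left nhdsWithin_le_nhds
    have : |b| ≤ 0 := ge_of_tendsto hlim (by
      filter_upwards [Ioo_mem_nhdsGT hδ] with s hs using hd s hs.1 hs.2)
    exact abs_nonpos_iff.1 this
  refine ⟨hb, le_of_forall_pos_le_add fun ε hε => ?_⟩
  obtain ⟨δ, hδ, hk⟩ := Metric.eventually_nhds_iff.1 (key ε hε)
  have h1 := hk (y := δ / 2) (by simp [abs_of_pos hδ, hδ])
  rw [hb] at h1
  have : 0 < (δ / 2) ^ 2 := by positivity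
  nlinarith

theorem le (h : HasJet w a b c) (h' : HasJet w' a b' c') (hw : ∀ᶠ t in nhds 0, w t ≤ w' t) :
    b = b' ∧ c ≤ c' := by
  have := nonneg ((h'.sub h).congr (sub_self a) rfl rfl) (hw.mono fun t ht => sub_nonneg.2 ht)
  exact ⟨by linarith [this.1], by linarith [this.2]⟩

theorem unique (h : HasJet w a b c) (h' : HasJet w' a b' c') (hw : ∀ᶠ t in nhds 0, w t = w' t) :
    b = b' ∧ c = c' := by
  have h1 := h.le h' (hw.mono fun t => le_of_eq)
  have h2 := h'.le h (hw.mono fun t ht => ht.ge)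
  exact ⟨h1.1, le_antisymm h1.2 h2.2⟩

theorem of_hasDerivAt {g g' : ℝ → ℝ} {k : ℝ} (h : ∀ᶠ t in nhds 0, HasDerivAt g (g' t) t)
    (h' : HasDerivAt g' k 0) : HasJet g (g 0) (g' 0) (k / 2) := by
  obtain ⟨δ, hδ, hd⟩ := Metric.eventually_nhds_iff.1 h
  have hmem : (0 : ℝ) ∈ Metric.ball (0 : ℝ) δ := Metric.mem_ball_self hδ
  have hnhds : nhdsWithin (0 : ℝ) (Metric.ball 0 δ) = nhds 0 :=
    Metric.isOpen_ball.nhdsWithin_eq hmem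
  have h1 : (fun t => g' t - g' 0 - k * t) =o[nhdsWithin 0 (Metric.ball 0 δ)]
      fun t : ℝ => (t - 0) ^ 1 := by
    rw [hnhds]
    simpa [mul_comm] using h'.isLittleO
  have h2 := (convex_ball (0 : ℝ) δ).isLittleO_pow_succ_real hmem
    (f := fun t => g t - g' 0 * t - k / 2 * t ^ 2) (fun t ht => by
      have e := ((hd ht).sub ((hasDerivAt_id t).const_mul (g' 0))).sub
        (((hasDerivAt_id t).pow 2).const_mul (k / 2))
      refine (e.congr_deriv ?_).hasDerivWithinAt
      simp
      ring) h1
  rw [hnhds] at h2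
  simp only [sub_zero] at h2
  refine h2.congr_left fun t => ?_
  simp
  ring

end HasJet

theorem fderiv_apply_eq_sum (f : (Fin 4 → ℝ) → ℝ) (y ξ : Fin 4 → ℝ) :
    fderiv ℝ f y ξ = ∑ i, ξ i * pd f i y := by
  conv_lhs => rw [pi_eq_sum_univ' ξ]
  simp only [map_sum, map_smul, smul_eq_mul, pd]

theorem hasDerivAt_line {f : (Fin 4 → ℝ) → ℝ} {x ξ : Fin 4 → ℝ} {t : ℝ}
    (h : DifferentiableAt ℝ f (x + t • ξ)) :
    HasDerivAt (fun s : ℝ => f (x + s • ξ)) (∑ i, ξ i * pd f i (x + t • ξ)) t := by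
  rw [← fderiv_apply_eq_sum]
  have h1 : HasDerivAt (fun s : ℝ => x + s • ξ) ξ t := by
    simpa using ((hasDerivAt_id t).smul_const ξ).const_add x
  exact h.hasFDerivAt.comp_hasDerivAt t h1

theorem tendsto_line (x ξ : Fin 4 → ℝ) :
    Filter.Tendsto (fun t : ℝ => x + t • ξ) (nhds 0) (nhds x) := by
  have : Continuous fun t : ℝ => x + t • ξ := by fun_prop
  simpa using this.tendsto 0

theorem contDiffAt_pd {f : (Fin 4 → ℝ) → ℝ} {x : Fin 4 → ℝ} {m n : WithTop ℕ∞}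
    (hf : ContDiffAt ℝ n f x) (hmn : m + 1 ≤ n) (i : Fin 4) :
    ContDiffAt ℝ m (fun y => pd f i y) x :=
  (hf.fderiv_right hmn).clm_apply contDiffAt_const

theorem HasJet.line {f : (Fin 4 → ℝ) → ℝ} {x : Fin 4 → ℝ} (hf : ContDiffAt ℝ 2 f x)
    (ξ : Fin 4 → ℝ) :
    HasJet (fun t => f (x + t • ξ)) (f x) (∑ i, ξ i * pd f i x)
      ((∑ i, ∑ j, ξ i * ξ j * pd2 f i j x) / 2) := by
  have h1 : ∀ᶠ y in nhds x, DifferentiableAt ℝ f y :=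
    (hf.eventually (by simp)).mono fun y hy => hy.differentiableAt (by simp)
  have h2 : ∀ i, HasDerivAt (fun t : ℝ => pd f i (x + t • ξ)) (∑ j, ξ j * pd2 f i j x) 0 := by
    intro i
    have hd : DifferentiableAt ℝ (fun y => pd f i y) x :=
      (contDiffAt_pd (m := 1) hf (by norm_num) i).differentiableAt (by simp)
    have := hasDerivAt_line (f := fun y => pd f i y) (x := x) (ξ := ξ) (t := 0) (by simpa using hd)
    simpa [pd2] using this
  have h3 := HasJet.of_hasDerivAt (g := fun t : ℝ => f (x + t • ξ))
    (g' := fun t => ∑ i, ξ i * pd f i (x + t • ξ))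
    (((tendsto_line x ξ).eventually h1).mono fun t ht => hasDerivAt_line ht)
    (HasDerivAt.fun_sum fun i _ => (h2 i).const_mul (ξ i))
  refine h3.congr (by simp) (by simp) ?_
  simp only [Finset.mul_sum, mul_assoc]

theorem pd2_symm {f : (Fin 4 → ℝ) → ℝ} {x : Fin 4 → ℝ} (hf : ContDiffAt ℝ 2 f x) (i j : Fin 4) :
    pd2 f i j x = pd2 f j i x := by
  have h : ∀ i j, pd2 f i j x = fderiv ℝ (fderiv ℝ f) x (Pi.single j 1) (Pi.single i 1) := by
    intro i j
    have hd : DifferentiableAt ℝ (fderiv ℝ f) x :=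
      (hf.fderiv_right (m := 1) (by norm_num)).differentiableAt (by simp)
    simp only [pd2]
    rw [pd]
    have : (fun y => pd f i y) = fun y => fderiv ℝ f y (Pi.single i 1) := rfl
    rw [this, fderiv_clm_apply hd (differentiableAt_const _)]
    simp
  rw [h, h]
  exact hf.isSymmSndFDerivAt (by simp) _ _

theorem sigma3_of_symm (A : Matrix (Fin 4) (Fin 4) ℝ) (hA : ∀ i j, A i j = A j i) :
    sigma3 A
      = (A 1 1 * A 2 2 * A 3 3 + 2 * (A 1 2 * A 1 3 * A 2 3)
          - A 1 1 * (A 2 3 * A 2 3) - A 2 2 * (A 1 3 * A 1 3) - A 3 3 * (A 1 2 * A 1 2))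
        + (A 0 0 * A 2 2 * A 3 3 + 2 * (A 0 2 * A 0 3 * A 2 3)
          - A 0 0 * (A 2 3 * A 2 3) - A 2 2 * (A 0 3 * A 0 3) - A 3 3 * (A 0 2 * A 0 2))
        + (A 0 0 * A 1 1 * A 3 3 + 2 * (A 0 1 * A 0 3 * A 1 3)
          - A 0 0 * (A 1 3 * A 1 3) - A 1 1 * (A 0 3 * A 0 3) - A 3 3 * (A 0 1 * A 0 1))
        + (A 0 0 * A 1 1 * A 2 2 + 2 * (A 0 1 * A 0 2 * A 1 2)
          - A 0 0 * (A 1 2 * A 1 2) - A 1 1 * (A 0 2 * A 0 2) - A 2 2 * (A 0 1 * A 0 1)) := by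
  simp only [sigma3, Matrix.trace, Matrix.diag_apply, Fin.sum_univ_four,
    Matrix.adjugate_fin_succ_eq_det_submatrix, Matrix.det_fin_three, Matrix.submatrix_apply]
  simp [Fin.succAbove, Fin.lt_def]
  rw [hA 1 0, hA 2 0, hA 3 0, hA 2 1, hA 3 1, hA 3 2]
  ring

theorem HasJet.polarDet {K : ℝ → Fin 4 → Fin 4 → ℝ} {K₀ K₁ K₂ : Fin 4 → Fin 4 → ℝ}
    (h : ∀ i j, HasJet (fun t => K t i j) (K₀ i j) (K₁ i j) (K₂ i j)) :
    HasJet (fun t => polarDet (K t) (K t)) (polarDet K₀ K₀) (2 * polarDet K₀ K₁)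
      (2 * polarDet K₀ K₂ + polarDet K₁ K₁) := by
  have h1 := ((h 1 1).add (h 3 3)).mul ((h 0 0).add (h 2 2))
  have h2 := ((h 0 0).add (h 2 2)).mul ((h 1 1).add (h 3 3))
  have h3 := (((h 0 1).add (h 2 3)).const_mul 2).mul ((h 0 1).add (h 2 3))
  have h4 := (((h 0 3).sub (h 1 2)).const_mul 2).mul ((h 0 3).sub (h 1 2))
  refine (((h1.add h2).sub h3).sub h4).congr ?_ ?_ ?_ <;> simp only [_root_.polarDet] <;> ring

theorem HasJet.minor {x y z u v w : ℝ → ℝ} {x₀ y₀ z₀ x₁ y₁ z₁ x₂ y₂ z₂ u₁ v₁ w₁ u₂ v₂ w₂ : ℝ}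
    (hx : HasJet x x₀ x₁ x₂) (hy : HasJet y y₀ y₁ y₂) (hz : HasJet z z₀ z₁ z₂)
    (hu : HasJet u 0 u₁ u₂) (hv : HasJet v 0 v₁ v₂) (hw : HasJet w 0 w₁ w₂) :
    HasJet (fun t => x t * y t * z t + 2 * (u t * v t * w t) - x t * (w t * w t)
        - y t * (v t * v t) - z t * (u t * u t))
      (x₀ * y₀ * z₀) (x₁ * y₀ * z₀ + x₀ * y₁ * z₀ + x₀ * y₀ * z₁)
      (x₂ * y₀ * z₀ + x₀ * y₂ * z₀ + x₀ * y₀ * z₂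
        + (x₀ * (y₁ * z₁ - w₁ ^ 2) + y₀ * (x₁ * z₁ - v₁ ^ 2) + z₀ * (x₁ * y₁ - u₁ ^ 2))) := by
  refine ((((((hx.mul hy).mul hz).add (((hu.mul hv).mul hw).const_mul 2)).sub
    (hx.mul (hw.mul hw))).sub (hy.mul (hv.mul hv))).sub (hz.mul (hu.mul hu))).congr ?_ ?_ ?_ <;>
    ring

theorem HasJet.sigma3 {M : ℝ → Matrix (Fin 4) (Fin 4) ℝ} {l : Fin 4 → ℝ} {X Y : Fin 4 → Fin 4 → ℝ}
    (hM : ∀ᶠ t in nhds 0, ∀ i j, M t i j = M t j i)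
    (h : ∀ i j, HasJet (fun t => M t i j) (Matrix.diagonal l i j) (X i j) (Y i j)) :
    HasJet (fun t => sigma3 (M t)) (_root_.sigma3 (Matrix.diagonal l))
      (∑ a, sigma2Compl l a * X a a) (∑ a, sigma2Compl l a * Y a a + sigma3Quad l X / 2) := by
  have hd : ∀ i, HasJet (fun t => M t i i) (l i) (X i i) (Y i i) := fun i => by simpa using h i i
  have ho : ∀ i j, i ≠ j → HasJet (fun t => M t i j) 0 (X i j) (Y i j) := fun i j hij => by
    simpa [hij] using h i j
  have h1 := (hd 1).minor (hd 2) (hd 3) (ho 1 2 (by decide)) (ho 1 3 (by decide)) (ho 2 3 (by decide))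
  have h2 := (hd 0).minor (hd 2) (hd 3) (ho 0 2 (by decide)) (ho 0 3 (by decide)) (ho 2 3 (by decide))
  have h3 := (hd 0).minor (hd 1) (hd 3) (ho 0 1 (by decide)) (ho 0 3 (by decide)) (ho 1 3 (by decide))
  have h4 := (hd 0).minor (hd 1) (hd 2) (ho 0 1 (by decide)) (ho 0 2 (by decide)) (ho 1 2 (by decide))
  rw [sigma3_of_symm _ fun i j => congrFun₂ (Matrix.diagonal_transpose l).symm i j]
  refine ((((h1.add h2).add h3).add h4).congr_of_eventuallyEq
    (hM.mono fun t => sigma3_of_symm (M t))).congr ?_ ?_ ?_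
  · simp
  · simp [sigma2Compl, Fin.sum_univ_four]
    ring
  · simp [sigma2Compl, sigma3Quad, Fin.sum_univ_four]
    ring

/-- The quadratic barrier `tr(Cᵀ M C)`. -/
def traceQuad (C M : Matrix (Fin 4) (Fin 4) ℝ) : ℝ :=
  ∑ b, ∑ a, ∑ a', C a b * M a a' * C a' b

theorem traceQuad_eq (C M : Matrix (Fin 4) (Fin 4) ℝ) :
    traceQuad C M = (C.transpose * M * C).trace := by
  simp only [traceQuad, Matrix.trace, Matrix.diag_apply, Matrix.mul_apply, Matrix.transpose_apply,
    Finset.sum_mul]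
  exact Finset.sum_congr rfl fun b _ => Finset.sum_comm

theorem traceQuad_nonneg {M : Matrix (Fin 4) (Fin 4) ℝ} (hM : M.PosSemidef)
    (C : Matrix (Fin 4) (Fin 4) ℝ) : 0 ≤ traceQuad C M := by
  rw [traceQuad_eq]
  simpa using (hM.conjTranspose_mul_mul_same C).trace_nonneg

theorem quotient_le_traceQuad {M : Matrix (Fin 4) (Fin 4) ℝ} (hM : M.PosSemidef)
    {C : Matrix (Fin 4) (Fin 4) ℝ} (hC : C.trace = 1) :
    (if 0 < sigma3 M then M.det / sigma3 M else 0) ≤ traceQuad C M := by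
  split_ifs with h
  · have hs : M.transpose = M := by simpa using hM.isHermitian.eq
    have ha : M.adjugate.transpose = M.adjugate := by rw [Matrix.adjugate_transpose, hs]
    have h1 := traceQuad_nonneg hM (C - (sigma3 M)⁻¹ • M.adjugate)
    rw [traceQuad_eq] at h1 ⊢
    have e : (C - (sigma3 M)⁻¹ • M.adjugate).transpose * M * (C - (sigma3 M)⁻¹ • M.adjugate)
        = C.transpose * M * C - ((sigma3 M)⁻¹ * M.det) • C.transpose
          - ((sigma3 M)⁻¹ * M.det) • C
          + ((sigma3 M)⁻¹ * M.det * (sigma3 M)⁻¹) • M.adjugate := by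
      simp only [Matrix.transpose_sub, Matrix.transpose_smul, ha, Matrix.sub_mul, Matrix.mul_sub,
        Matrix.smul_mul, Matrix.mul_smul, Matrix.mul_assoc, Matrix.mul_adjugate,
        Matrix.mul_one]
      rw [← Matrix.mul_assoc M.adjugate M C, Matrix.adjugate_mul, Matrix.smul_mul, Matrix.one_mul]
      module
    rw [e, Matrix.trace_add, Matrix.trace_sub, Matrix.trace_sub, Matrix.trace_smul,
      Matrix.trace_smul, Matrix.trace_smul, Matrix.trace_transpose, hC,
      show M.adjugate.trace = sigma3 M from rfl] at h1
    simp only [smul_eq_mul, mul_one] at h1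
    rw [inv_mul_cancel_right₀ h.ne'] at h1
    rw [div_eq_inv_mul]
    linarith
  · exact traceQuad_nonneg hM C

theorem HasJet.traceQuad {M : ℝ → Matrix (Fin 4) (Fin 4) ℝ} {l c : Fin 4 → ℝ}
    {X Y : Fin 4 → Fin 4 → ℝ} {D : Fin 4 → Fin 4 → ℝ} (hX : ∀ i j, X i j = X j i)
    (hD : ∑ a, D a a = 0) (hcl : ∀ a, c a * l a = c 0 * l 0)
    (h : ∀ i j, HasJet (fun t => M t i j) (Matrix.diagonal l i j) (X i j) (Y i j)) :
    HasJet (fun t => traceQuad (Matrix.diagonal c + t • Matrix.of D) (M t))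
      (∑ a, c a ^ 2 * l a) (∑ a, c a ^ 2 * X a a)
      (∑ a, c a ^ 2 * Y a a + 2 * ∑ a, ∑ b, D a b * X a b * c b + ∑ a, ∑ b, l a * D a b ^ 2) := by
  have hC : ∀ a b, HasJet (fun t => (Matrix.diagonal c + t • Matrix.of D) a b)
      (Matrix.diagonal c a b) (D a b) 0 := by
    intro a b
    have e : (fun t : ℝ => (Matrix.diagonal c + t • Matrix.of D) a b)
        = fun t => Matrix.diagonal c a b + D a b * t := funext fun t => by simp [mul_comm]
    rw [e]
    exact ((HasJet.const _).add (HasJet.id.const_mul (D a b))).congr (by simp) (by simp) (by simp)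
  have key := HasJet.sum Finset.univ fun b _ => HasJet.sum Finset.univ fun a _ =>
    HasJet.sum Finset.univ fun a' _ => ((hC a b).mul (h a a')).mul (hC a' b)
  refine key.congr ?_ ?_ ?_
  · simp [Matrix.diagonal_apply]
    exact Finset.sum_congr rfl fun a _ => by ring
  · have : ∑ a, c a ^ 2 * X a a = ∑ a, (c a ^ 2 * X a a + 2 * (c a * l a) * D a a) := by
      simp only [hcl]
      rw [Finset.sum_add_distrib, ← Finset.mul_sum, hD]
      simp
    rw [this]
    simp [Fin.sum_univ_four, Matrix.diagonal_apply]
    ring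
  · simp [Fin.sum_univ_four, Matrix.diagonal_apply]
    rw [hX 1 0, hX 2 0, hX 3 0, hX 2 1, hX 3 1, hX 3 2]
    ring

/-- An orthonormal eigenframe of a symmetric matrix, with increasing eigenvalues. -/
structure IsEigenframe (M U : Matrix (Fin 4) (Fin 4) ℝ) (l : Fin 4 → ℝ) : Prop where
  left : U.transpose * U = 1
  right : U * U.transpose = 1
  diag : U.transpose * M * U = Matrix.diagonal l
  mono : Monotone l

theorem exists_isEigenframe {M : Matrix (Fin 4) (Fin 4) ℝ} (hM : M.PosSemidef) :
    ∃ U l, IsEigenframe M U l ∧ ∀ a, 0 ≤ l a := by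
  have hH := hM.isHermitian
  set σ := Tuple.sort hH.eigenvalues with hσ
  set V : Matrix (Fin 4) (Fin 4) ℝ := hH.eigenvectorUnitary.1 with hV
  have hVl : V.transpose * V = 1 := by
    simpa [Matrix.star_eq_conjTranspose] using Unitary.coe_star_mul_self hH.eigenvectorUnitary
  have hd : V.transpose * M * V = Matrix.diagonal hH.eigenvalues := by
    simpa [Matrix.star_eq_conjTranspose, Unitary.conjStarAlgAut_apply] using hH.conjStarAlgAut_star_eigenvectorUnitary
  have hl : (V.submatrix _root_.id σ).transpose * V.submatrix _root_.id σ = 1 := by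
    rw [← Matrix.submatrix_one_equiv σ, ← hVl]
    ext i j
    simp [Matrix.mul_apply]
  refine ⟨V.submatrix _root_.id σ, hH.eigenvalues ∘ σ,
    ⟨hl, mul_eq_one_comm.1 hl, ?_, Tuple.monotone_sort _⟩, fun a => hM.eigenvalues_nonneg _⟩
  have : (V.submatrix _root_.id σ).transpose * M * V.submatrix _root_.id σ
      = (V.transpose * M * V).submatrix σ σ := by
    ext i j
    simp [Matrix.mul_apply]
  rw [this, hd]
  ext i j
  simp [Matrix.diagonal_apply]

theorem sigma3_diagonal (l : Fin 4 → ℝ) : sigma3 (Matrix.diagonal l)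
    = l 1 * l 2 * l 3 + l 0 * l 2 * l 3 + l 0 * l 1 * l 3 + l 0 * l 1 * l 2 := by
  rw [sigma3_of_symm _ fun i j => congrFun₂ (Matrix.diagonal_transpose l).symm i j]
  simp

namespace IsEigenframe

variable {M U : Matrix (Fin 4) (Fin 4) ℝ} {l : Fin 4 → ℝ}

theorem sigma3_conj (h : IsEigenframe M U l) (N : Matrix (Fin 4) (Fin 4) ℝ) :
    sigma3 (U.transpose * N * U) = sigma3 N := by
  simp only [sigma3, Matrix.adjugate_mul_distrib]
  rw [Matrix.trace_mul_comm, Matrix.mul_assoc, ← Matrix.adjugate_mul_distrib, h.right]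
  simp

theorem det_conj (h : IsEigenframe M U l) (N : Matrix (Fin 4) (Fin 4) ℝ) :
    (U.transpose * N * U).det = N.det := by
  rw [Matrix.det_mul, Matrix.det_mul, mul_right_comm, ← Matrix.det_mul, h.left]
  simp

theorem eq_mul (h : IsEigenframe M U l) : M = U * Matrix.diagonal l * U.transpose := by
  rw [← h.diag, ← Matrix.mul_assoc, ← Matrix.mul_assoc, h.right, Matrix.one_mul, Matrix.mul_assoc,
    h.right, Matrix.mul_one]

theorem apply_eq (h : IsEigenframe M U l) (i j : Fin 4) :
    M i j = ∑ a, l a * U i a * U j a := by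
  conv_lhs => rw [h.eq_mul]
  rw [Matrix.mul_apply]
  simp only [Matrix.mul_diagonal, Matrix.transpose_apply]
  exact Finset.sum_congr rfl fun a _ => by ring

theorem sum_mul_eq (h : IsEigenframe M U l) (a i : Fin 4) :
    ∑ k, U k a * M i k = l a * U i a := by
  have : M * U = U * Matrix.diagonal l := by
    rw [h.eq_mul, Matrix.mul_assoc, h.left, Matrix.mul_one]
  have := congrFun₂ this i a
  rw [Matrix.mul_diagonal, Matrix.mul_apply] at this
  rw [mul_comm, ← this]
  exact Finset.sum_congr rfl fun k _ => mul_comm _ _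

theorem sum_sum_eq (h : IsEigenframe M U l) (a b : Fin 4) :
    ∑ i, ∑ j, U i a * U j b * M i j = Matrix.diagonal l a b := by
  rw [← h.diag, Finset.sum_comm]
  simp only [Matrix.mul_apply, Matrix.transpose_apply, Finset.sum_mul]
  exact Finset.sum_congr rfl fun j _ => Finset.sum_congr rfl fun i _ => by ring

theorem sum_mul_self (h : IsEigenframe M U l) (a : Fin 4) : ∑ i, U i a ^ 2 = 1 := by
  have := congrFun₂ h.left a a
  simpa [Matrix.mul_apply, sq] using this

theorem sum_col (h : IsEigenframe M U l) (i j : Fin 4) :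
    ∑ a, U i a * U j a = if i = j then 1 else 0 := by
  simpa [Matrix.mul_apply, Matrix.one_apply] using congrFun₂ h.right i j

theorem abs_le_one (h : IsEigenframe M U l) (i a : Fin 4) : |U i a| ≤ 1 := by
  rw [← sq_le_one_iff_abs_le_one, ← h.sum_mul_self a]
  exact Finset.single_le_sum (f := fun i => U i a ^ 2) (fun i _ => sq_nonneg _) (Finset.mem_univ i)

theorem sigma3_eq (h : IsEigenframe M U l) : sigma3 M
    = l 1 * l 2 * l 3 + l 0 * l 2 * l 3 + l 0 * l 1 * l 3 + l 0 * l 1 * l 2 := by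
  rw [← h.sigma3_conj, h.diag, sigma3_diagonal]

theorem trace_eq (h : IsEigenframe M U l) : M.trace = ∑ a, l a := by
  rw [h.eq_mul, Matrix.trace_mul_comm, ← Matrix.mul_assoc, h.left, Matrix.one_mul,
    Matrix.trace_diagonal]

theorem trace_mul_self (h : IsEigenframe M U l) : (M * M).trace = ∑ a, l a ^ 2 := by
  have : M * M = U * Matrix.diagonal (fun a => l a * l a) * U.transpose := by
    rw [← Matrix.diagonal_mul_diagonal, h.eq_mul]
    simp only [Matrix.mul_assoc]
    rw [← Matrix.mul_assoc U.transpose U, h.left, Matrix.one_mul]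
  rw [this, Matrix.trace_mul_comm, ← Matrix.mul_assoc, h.left, Matrix.one_mul,
    Matrix.trace_diagonal]
  simp only [sq]

theorem rank_eq (h : IsEigenframe M U l) : M.rank = Fintype.card {a // l a ≠ 0} := by
  have hU : IsUnit U.det := (Matrix.isUnit_iff_isUnit_det U).1 (IsUnit.of_mul_eq_one _ h.right)
  rw [h.eq_mul, Matrix.rank_mul_eq_left_of_isUnit_det _ _ (by rwa [Matrix.det_transpose]),
    Matrix.rank_mul_eq_right_of_isUnit_det _ _ hU, Matrix.rank_diagonal]

theorem of_rank_two (h : IsEigenframe M U l) (hl : ∀ a, 0 ≤ l a) (hr : M.rank = 2) :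
    l 1 = 0 ∧ 0 < l 2 := by
  rw [h.rank_eq] at hr
  have h12 : l 1 ≤ l 2 := h.mono (by decide)
  have h01 : l 0 ≤ l 1 := h.mono (by decide)
  have h23 : l 2 ≤ l 3 := h.mono (by decide)
  constructor
  · by_contra h1
    have p1 : 0 < l 1 := lt_of_le_of_ne (hl 1) (Ne.symm h1)
    have : ({1, 2, 3} : Finset (Fin 4)).card ≤ Fintype.card {a // l a ≠ 0} := by
      rw [Fintype.card_subtype]
      refine Finset.card_le_card fun a ha => ?_
      simp only [Finset.mem_insert, Finset.mem_singleton] at ha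
      rw [Finset.mem_filter]
      refine ⟨Finset.mem_univ _, ?_⟩
      rcases ha with rfl | rfl | rfl <;> linarith
    have e : ({1, 2, 3} : Finset (Fin 4)).card = 3 := by decide
    omega
  · by_contra h2
    have z2 : l 2 = 0 := le_antisymm (not_lt.1 h2) (hl 2)
    have : Fintype.card {a // l a ≠ 0} ≤ ({3} : Finset (Fin 4)).card := by
      rw [Fintype.card_subtype]
      refine Finset.card_le_card fun a ha => ?_
      rw [Finset.mem_filter] at ha
      have h0 := hl 0
      have h1 := hl 1
      have z1 : l 1 = 0 := by linarith
      have z0 : l 0 = 0 := by linarith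
      have := ha.2
      fin_cases a
      · exact absurd z0 this
      · exact absurd z1 this
      · exact absurd z2 this
      · simp
    rw [hr, Finset.card_singleton] at this
    omega

/-- Lower bound for the upper eigenvalues and upper bound for the lower ones. -/
theorem bounds (h : IsEigenframe M U l) (hl : ∀ a, 0 ≤ l a) {m β : ℝ} (hm : 0 < m)
    (hlm : ∀ a, l a ≤ m) (hβ : 0 < β) (hσ : 12 * m * β ≤ M.trace ^ 2 - (M * M).trace) :
    β ≤ l 2 ∧ β ≤ l 3 ∧ β ^ 2 * l 1 ≤ sigma3 M := by
  have h12 : l 1 ≤ l 2 := h.mono (by decide)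
  have h01 : l 0 ≤ l 1 := h.mono (by decide)
  have h23 : l 2 ≤ l 3 := h.mono (by decide)
  rw [h.trace_eq, h.trace_mul_self, Fin.sum_univ_four, Fin.sum_univ_four] at hσ
  have n0 := hl 0
  have n1 := hl 1
  have n2 := hl 2
  have n3 := hl 3
  have m3 := hlm 3
  have key : ∀ a b, 0 ≤ a → a ≤ l 2 → 0 ≤ b → b ≤ l 3 → a * b ≤ l 2 * m := fun a b ha ha' hb hb' =>
    mul_le_mul ha' (hb'.trans m3) hb n2
  have k1 := key (l 0) (l 1) n0 (h01.trans h12) n1 (h12.trans h23)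
  have k2 := key (l 0) (l 2) n0 (h01.trans h12) n2 h23
  have k3 := key (l 0) (l 3) n0 (h01.trans h12) n3 le_rfl
  have k4 := key (l 1) (l 2) n1 h12 n2 h23
  have k5 := key (l 1) (l 3) n1 h12 n3 le_rfl
  have k6 := key (l 2) (l 3) n2 le_rfl n3 le_rfl
  have b2 : β ≤ l 2 := by
    refine le_of_mul_le_mul_left (a := 12 * m) ?_ (by positivity)
    nlinarith
  refine ⟨b2, b2.trans h23, ?_⟩
  rw [h.sigma3_eq]
  have : β ^ 2 * l 1 ≤ l 1 * l 2 * l 3 := by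
    have : β ^ 2 ≤ l 2 * l 3 := by nlinarith
    nlinarith
  have e1 : 0 ≤ l 0 * l 2 * l 3 := by positivity
  have e2 : 0 ≤ l 0 * l 1 * l 3 := by positivity
  have e3 : 0 ≤ l 0 * l 1 * l 2 := by positivity
  linarith

end IsEigenframe

/-- Weights for which `quotient_le_traceQuad` is an equality at a diagonal matrix. -/
theorem exists_weights {l : Fin 4 → ℝ} (hl : ∀ a, 0 ≤ l a) (hmono : Monotone l) {β : ℝ}
    (hβ : 0 < β) (h2 : β ≤ l 2) (h0 : 4 * l 0 ≤ β) :
    ∃ c : Fin 4 → ℝ, (∀ a, 0 ≤ c a) ∧ ∑ a, c a = 1 ∧ (∀ a, c a * l a = c 0 * l 0) ∧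
      1 / 2 ≤ c 0 + c 1 ∧
      (if 0 < sigma3 (Matrix.diagonal l) then
        (Matrix.diagonal l).det / sigma3 (Matrix.diagonal l) else 0) = ∑ a, c a ^ 2 * l a := by
  have h12 : l 1 ≤ l 2 := hmono (by decide)
  have h01 : l 0 ≤ l 1 := hmono (by decide)
  have h23 : l 2 ≤ l 3 := hmono (by decide)
  have p2 : 0 < l 2 := hβ.trans_le h2
  have p3 : 0 < l 3 := p2.trans_le h23
  have n0 := hl 0
  have n1 := hl 1
  rw [sigma3_diagonal, Matrix.det_diagonal, Fin.prod_univ_four]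
  split_ifs with hs
  · set s := l 1 * l 2 * l 3 + l 0 * l 2 * l 3 + l 0 * l 1 * l 3 + l 0 * l 1 * l 2 with hsd
    refine ⟨![l 1 * l 2 * l 3 / s, l 0 * l 2 * l 3 / s, l 0 * l 1 * l 3 / s, l 0 * l 1 * l 2 / s],
      ?_, ?_, ?_, ?_, ?_⟩
    · intro a
      fin_cases a <;> simp <;> positivity
    · simp only [Fin.sum_univ_four, Matrix.cons_val]
      rw [← add_div, ← add_div, ← add_div, div_self hs.ne']
    · intro a
      fin_cases a <;> simp <;> ring
    · simp only [Matrix.cons_val]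
      rw [← add_div, le_div_iff₀ hs]
      have e1 : l 0 * l 1 * l 3 ≤ l 1 * l 2 * l 3 / 4 := by
        have : l 0 * (l 1 * l 3) ≤ l 2 / 4 * (l 1 * l 3) :=
          mul_le_mul_of_nonneg_right (by linarith) (by positivity)
        linarith
      have e2 : l 0 * l 1 * l 2 ≤ l 1 * l 2 * l 3 / 4 := by
        have : l 0 * (l 1 * l 2) ≤ l 3 / 4 * (l 1 * l 2) :=
          mul_le_mul_of_nonneg_right (by linarith) (by positivity)
        linarith
      have e3 : 0 ≤ l 1 * l 2 * l 3 := by positivity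
      have e4 : 0 ≤ l 0 * l 2 * l 3 := by positivity
      linarith
    · simp only [Fin.sum_univ_four, Matrix.cons_val]
      field_simp
      rw [hsd]
      ring
  · have z1 : l 1 = 0 := by
      by_contra hne
      have p1 : 0 < l 1 := lt_of_le_of_ne n1 (Ne.symm hne)
      exact hs (by positivity)
    have z0 : l 0 = 0 := by linarith
    refine ⟨![1, 0, 0, 0], ?_, ?_, ?_, ?_, ?_⟩
    · intro a
      fin_cases a <;> simp
    · simp [Fin.sum_univ_four]
    · intro a
      fin_cases a <;> simp [z0]
    · norm_num
    · simp [Fin.sum_univ_four, z0]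

/-- Third derivatives. -/
noncomputable def pd3 (f : (Fin 4 → ℝ) → ℝ) (i j k : Fin 4) (x : Fin 4 → ℝ) : ℝ :=
  pd (fun y => pd2 f i j y) k x

/-- Fourth derivatives. -/
noncomputable def pd4 (f : (Fin 4 → ℝ) → ℝ) (i j k l : Fin 4) (x : Fin 4 → ℝ) : ℝ :=
  pd (fun y => pd3 f i j k y) l x

theorem pd_congr {f g : (Fin 4 → ℝ) → ℝ} {x : Fin 4 → ℝ} (h : ∀ᶠ y in nhds x, f y = g y)
    (i : Fin 4) : pd f i x = pd g i x := by
  rw [pd, pd, Filter.EventuallyEq.fderiv_eq h]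

section Smooth

variable {v : (Fin 4 → ℝ) → ℝ} {x : Fin 4 → ℝ}

theorem contDiffAt_pd2 {m n : WithTop ℕ∞} (hv : ContDiffAt ℝ n v x) (hmn : m + 1 + 1 ≤ n)
    (i j : Fin 4) : ContDiffAt ℝ m (fun y => pd2 v i j y) x :=
  contDiffAt_pd (contDiffAt_pd hv hmn i) le_rfl j

theorem continuousAt_pd (hv : ContDiffAt ℝ 4 v x) (i : Fin 4) :
    ContinuousAt (fun y => pd v i y) x :=
  (contDiffAt_pd (m := 3) hv (by norm_num) i).continuousAt

theorem continuousAt_pd2 (hv : ContDiffAt ℝ 4 v x) (i j : Fin 4) :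
    ContinuousAt (fun y => pd2 v i j y) x :=
  (contDiffAt_pd2 (m := 2) hv (by norm_num) i j).continuousAt

theorem continuousAt_pd3 (hv : ContDiffAt ℝ 4 v x) (i j k : Fin 4) :
    ContinuousAt (fun y => pd3 v i j k y) x :=
  (contDiffAt_pd (m := 1) (contDiffAt_pd2 (m := 2) hv (by norm_num) i j)
    (by norm_num) k).continuousAt

theorem continuousAt_pd4 (hv : ContDiffAt ℝ 4 v x) (i j k l : Fin 4) :
    ContinuousAt (fun y => pd4 v i j k l y) x :=
  (contDiffAt_pd (m := 0) (contDiffAt_pd (m := 1) (contDiffAt_pd2 (m := 2) hv (by norm_num) i j)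
    (by norm_num) k) (by norm_num) l).continuousAt

theorem pd3_symm_left (hv : ContDiffAt ℝ 4 v x) (i j k : Fin 4) :
    pd3 v i j k x = pd3 v j i k x :=
  pd_congr ((hv.eventually (by simp)).mono fun y hy =>
    pd2_symm (hy.of_le (by norm_num)) i j) k

theorem pd3_symm_right (hv : ContDiffAt ℝ 4 v x) (i j k : Fin 4) :
    pd3 v i j k x = pd3 v i k j x :=
  pd2_symm (contDiffAt_pd (m := 2) hv (by norm_num) i) j k

theorem pd4_symm_left (hv : ContDiffAt ℝ 4 v x) (i j k l : Fin 4) :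
    pd4 v i j k l x = pd4 v j i k l x :=
  pd_congr ((hv.eventually (by simp)).mono fun _ hy => pd3_symm_left hy i j k) l

theorem pd4_symm_mid (hv : ContDiffAt ℝ 4 v x) (i j k l : Fin 4) :
    pd4 v i j k l x = pd4 v i k j l x :=
  pd_congr ((hv.eventually (by simp)).mono fun _ hy => pd3_symm_right hy i j k) l

theorem pd4_symm_right (hv : ContDiffAt ℝ 4 v x) (i j k l : Fin 4) :
    pd4 v i j k l x = pd4 v i j l k x :=
  pd2_symm (contDiffAt_pd2 (m := 2) hv (by norm_num) i j) k l

theorem pd4_swap (hv : ContDiffAt ℝ 4 v x) (i j k l : Fin 4) :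
    pd4 v i j k l x = pd4 v k l i j x := by
  rw [pd4_symm_mid hv, pd4_symm_left hv, pd4_symm_right hv, pd4_symm_mid hv]

theorem hasJet_pd (hv : ContDiffAt ℝ 4 v x) (ξ : Fin 4 → ℝ) (i : Fin 4) :
    HasJet (fun t => pd v i (x + t • ξ)) (pd v i x) (∑ k, ξ k * pd2 v i k x)
      ((∑ k, ∑ l, ξ k * ξ l * pd3 v i k l x) / 2) :=
  HasJet.line (contDiffAt_pd (m := 2) hv (by norm_num) i) ξ

theorem hasJet_pd2 (hv : ContDiffAt ℝ 4 v x) (ξ : Fin 4 → ℝ) (i j : Fin 4) :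
    HasJet (fun t => pd2 v i j (x + t • ξ)) (pd2 v i j x) (∑ k, ξ k * pd3 v i j k x)
      ((∑ k, ∑ l, ξ k * ξ l * pd4 v i j k l x) / 2) :=
  HasJet.line (contDiffAt_pd2 (m := 2) hv (by norm_num) i j) ξ

end Smooth

theorem hessM_posSemidef {Ω : Set (Fin 4 → ℝ)} {v : (Fin 4 → ℝ) → ℝ} {x : Fin 4 → ℝ}
    (hΩ : Ω ∈ nhds x) (hconv : ConvexOn ℝ Ω v) (hv : ContDiffAt ℝ 2 v x) :
    (hessM v x).PosSemidef := by
  refine Matrix.PosSemidef.of_dotProduct_mulVec_nonneg ?_ fun ξ => ?_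
  · ext i j
    simp [hessM, pd2_symm hv i j]
  · have h1 := (HasJet.line hv ξ).add (HasJet.line hv (-ξ))
    have h2 := h1.sub (HasJet.const (2 * v x))
    have h3 := (h2.congr (a' := 0) (by ring) rfl rfl).nonneg (by
      filter_upwards [(tendsto_line x ξ).eventually hΩ, (tendsto_line x (-ξ)).eventually hΩ]
        with t ht ht'
      have := hconv.2 ht ht' (by norm_num : (0 : ℝ) ≤ 1 / 2) (by norm_num : (0 : ℝ) ≤ 1 / 2)
        (by norm_num)
      have e : (1 / 2 : ℝ) • (x + t • ξ) + (1 / 2 : ℝ) • (x + t • -ξ) = x := by module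
      rw [e, smul_eq_mul, smul_eq_mul] at this
      linarith)
    have h4 := h3.2
    simp only [Pi.neg_apply, neg_mul_neg, sub_zero, add_halves] at h4
    simp only [dotProduct, Matrix.mulVec, hessM, Matrix.of_apply, star_trivial, Finset.mul_sum]
    refine h4.trans_eq (Finset.sum_congr rfl fun i _ => Finset.sum_congr rfl fun j _ => by ring)

/-- The matrix `∇²v - ∇v ∇vᵀ`. -/
noncomputable def shiftM (v : (Fin 4 → ℝ) → ℝ) (x : Fin 4 → ℝ) (i j : Fin 4) : ℝ :=
  pd2 v i j x - pd v i x * pd v j x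

theorem StarEq.polarDet_shiftM {lam : ℝ} {v : (Fin 4 → ℝ) → ℝ} {Ω : Set (Fin 4 → ℝ)}
    (h : StarEq lam v Ω) {x : Fin 4 → ℝ} (hx : x ∈ Ω) :
    polarDet (shiftM v x) (shiftM v x) = 2 * lam := by
  rw [← h x hx]
  simp only [polarDet, shiftM]
  ring

theorem sum_Fm_mul (v : (Fin 4 → ℝ) → ℝ) (x : Fin 4 → ℝ) {N : Fin 4 → Fin 4 → ℝ}
    (hN : ∀ i j, N i j = N j i) :
    ∑ i, ∑ j, Fm v x i j * N i j = polarDet (shiftM v x) N := by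
  simp only [Fin.sum_univ_four, Fm, polarDet, shiftM, Matrix.of_apply, Matrix.cons_val]
  rw [hN 1 0, hN 2 1, hN 3 0, hN 3 2]
  ring

/-- The trace of the lower block of `∇²v - ∇v ∇vᵀ` is positive at a convex solution. -/
theorem shiftM_pos {lam : ℝ} (hlam : 0 < lam) {v : (Fin 4 → ℝ) → ℝ} {x : Fin 4 → ℝ}
    (hx : polarDet (shiftM v x) (shiftM v x) = 2 * lam) (hH : (hessM v x).PosSemidef) :
    0 < shiftM v x 1 1 + shiftM v x 3 3 := by
  set p : Fin 4 → ℝ := fun i => pd v i x with hp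
  have hq : ∀ w : Fin 4 → ℝ, 0 ≤ ∑ i, ∑ j, w i * (pd2 v i j x * w j) := by
    intro w
    simpa [dotProduct, Matrix.mulVec, hessM, Finset.mul_sum] using hH.dotProduct_mulVec_nonneg w
  have hsymm : ∀ i j, pd2 v i j x = pd2 v j i x := fun i j => by
    simpa [hessM] using congrFun₂ hH.isHermitian.eq j i
  have h1 := norm_sq_le_polarDet (shiftM v x) p lam hx
  have h2 : 0 ≤ polarDet (shiftM v x) fun i j => p i * p j := by
    have q1 := hq ![p 1, -p 0, -p 3, p 2]
    have q2 := hq ![p 3, -p 2, p 1, -p 0]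
    simp only [Fin.sum_univ_four, Matrix.cons_val] at q1 q2
    rw [hsymm 1 0, hsymm 2 0, hsymm 3 0, hsymm 2 1, hsymm 3 1, hsymm 3 2] at q1 q2
    simp only [polarDet, shiftM]
    simp only [hp] at q1 q2 ⊢
    linarith
  have hab : 0 < (shiftM v x 1 1 + shiftM v x 3 3) * (shiftM v x 0 0 + shiftM v x 2 2) := by
    simp only [polarDet] at hx
    nlinarith [sq_nonneg (shiftM v x 0 1 + shiftM v x 2 3),
      sq_nonneg (shiftM v x 0 3 - shiftM v x 1 2)]
  by_contra hneg
  have ha := not_lt.1 hneg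
  have hb : shiftM v x 0 0 + shiftM v x 2 2 ≤ 0 := by
    by_contra hb
    nlinarith [not_le.1 hb]
  have h3 : lam * ∑ i, p i ^ 2 ≤ 0 := h1.trans (mul_nonpos_of_nonpos_of_nonneg (by linarith) h2)
  have h4 : ∑ i, p i ^ 2 = 0 :=
    le_antisymm (nonpos_of_mul_nonpos_right h3 hlam) (Finset.sum_nonneg fun i _ => sq_nonneg _)
  have h5 : ∀ i, pd v i x = 0 := fun i => by
    simpa using (Finset.sum_eq_zero_iff_of_nonneg fun i _ => sq_nonneg (p i)).1 h4 i
      (Finset.mem_univ i)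
  have d1 := hq ![0, 1, 0, 0]
  have d3 := hq ![0, 0, 0, 1]
  simp [Fin.sum_univ_four] at d1 d3
  have ha' : shiftM v x 1 1 + shiftM v x 3 3 = 0 := by
    refine le_antisymm ha ?_
    simp only [shiftM, h5]
    linarith
  rw [ha', zero_mul] at hab
  exact lt_irrefl _ hab

/-- Derivatives of a function and of a test function in a frame. -/
noncomputable def frameData (v ψ : (Fin 4 → ℝ) → ℝ) (x : Fin 4 → ℝ)
    (U : Matrix (Fin 4) (Fin 4) ℝ) (l c : Fin 4 → ℝ) : FrameData where
  p i := pd v i x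
  e a i := U i a
  l := l
  c := c
  Xo a i j := ∑ k, U k a * pd3 v k i j x
  G a b i := ∑ j, U j b * ∑ k, U k a * pd3 v k j i x
  X3 a b c := ∑ i, U i c * ∑ j, U j b * ∑ k, U k a * pd3 v k j i x
  Z a i j := ∑ k, ∑ m, U k a * U m a * pd4 v k m i j x
  grad i := pd ψ i x
  hess i j := pd2 ψ i j x

theorem abs_sum_mul_le {u f : Fin 4 → ℝ} {B : ℝ} (hu : ∀ i, |u i| ≤ 1) (hf : ∀ i, |f i| ≤ B) :
    |∑ i, u i * f i| ≤ 4 * B := by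
  refine (Finset.abs_sum_le_sum_abs _ _).trans
    ((Finset.sum_le_sum (g := fun _ => B) fun i _ => ?_).trans_eq (by simp))
  rw [abs_mul]
  exact (mul_le_of_le_one_left (abs_nonneg _) (hu i)).trans (hf i)

namespace IsEigenframe

variable {M U : Matrix (Fin 4) (Fin 4) ℝ} {l : Fin 4 → ℝ}

theorem sum_expand (h : IsEigenframe M U l) (f : Fin 4 → ℝ) (i : Fin 4) :
    ∑ c, U i c * ∑ k, U k c * f k = f i := by
  have e : ∀ c, U i c * ∑ k, U k c * f k = ∑ k, U i c * U k c * f k := fun c => by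
    rw [Finset.mul_sum]
    exact Finset.sum_congr rfl fun k _ => (mul_assoc _ _ _).symm
  simp only [e]
  rw [Finset.sum_comm]
  simp only [← Finset.sum_mul, h.sum_col]
  simp

theorem abs_eigenvalue_le (h : IsEigenframe M U l) {B : ℝ} (hB : ∀ i j, |M i j| ≤ B) (a : Fin 4) :
    |l a| ≤ 4 * (4 * B) := by
  have e : l a = ∑ i, U i a * ∑ j, U j a * M i j := by
    have := h.sum_sum_eq a a
    rw [Matrix.diagonal_apply_eq] at this
    rw [← this]
    exact Finset.sum_congr rfl fun i _ => by
      rw [Finset.mul_sum]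
      exact Finset.sum_congr rfl fun j _ => mul_assoc _ _ _
  rw [e]
  exact abs_sum_mul_le (fun i => h.abs_le_one i a) fun i =>
    abs_sum_mul_le (fun j => h.abs_le_one j a) (hB i)

end IsEigenframe

section Point

variable {v ψ : (Fin 4 → ℝ) → ℝ} {x : Fin 4 → ℝ} {U : Matrix (Fin 4) (Fin 4) ℝ} {l c : Fin 4 → ℝ}

theorem gradShift_frameData (hU : IsEigenframe (hessM v x) U l) :
    gradShift l (frameData v ψ x U l c).p (frameData v ψ x U l c).e = shiftM v x := by
  ext i j
  have := hU.apply_eq i j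
  simp only [hessM, Matrix.of_apply] at this
  simp only [gradShift, shiftM, frameData, this]

theorem hasJet_shiftM (hv : ContDiffAt ℝ 4 v x) (hU : IsEigenframe (hessM v x) U l)
    (a i j : Fin 4) :
    HasJet (fun t => shiftM v (x + t • fun k => U k a) i j) (shiftM v x i j)
      (gradShift₁ l (frameData v ψ x U l c).p (frameData v ψ x U l c).e
        (frameData v ψ x U l c).Xo a i j)
      (gradShift₂ l (frameData v ψ x U l c).p (frameData v ψ x U l c).e
        (frameData v ψ x U l c).G (frameData v ψ x U l c).Z a i j / 2) := by
  have hp : ∀ i, HasJet (fun t => pd v i (x + t • fun k => U k a)) (pd v i x) (l a * U i a)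
      ((frameData v ψ x U l c).G a a i / 2) := fun i =>
    (hasJet_pd hv _ i).congr rfl (by simpa [hessM] using hU.sum_mul_eq a i) (by
      congr 1
      simp only [frameData, Finset.mul_sum]
      refine Finset.sum_congr rfl fun j _ => Finset.sum_congr rfl fun k _ => ?_
      rw [pd3_symm_left hv i j k, pd3_symm_right hv j i k, pd3_symm_left hv j k i]
      ring)
  have hh : HasJet (fun t => pd2 v i j (x + t • fun k => U k a)) (pd2 v i j x)
      ((frameData v ψ x U l c).Xo a i j) ((frameData v ψ x U l c).Z a i j / 2) :=
    (hasJet_pd2 hv _ i j).congr rfl (by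
      simp only [frameData]
      exact Finset.sum_congr rfl fun k _ => by
        rw [pd3_symm_right hv i j k, pd3_symm_left hv i k j]) (by
      congr 1
      simp only [frameData]
      exact Finset.sum_congr rfl fun k _ => Finset.sum_congr rfl fun m _ => by
        rw [pd4_swap hv])
  refine (hh.sub ((hp i).mul (hp j))).congr rfl ?_ ?_
  · simp only [gradShift₁, frameData]
    ring
  · simp only [gradShift₂]
    simp only [show (frameData v ψ x U l c).p = fun i => pd v i x from rfl,
      show (frameData v ψ x U l c).e = fun a i => U i a from rfl]
    ring

theorem hasJet_conj (hv : ContDiffAt ℝ 4 v x) (hU : IsEigenframe (hessM v x) U l)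
    (ξ : Fin 4 → ℝ) (a b : Fin 4) :
    HasJet (fun t => (U.transpose * hessM v (x + t • ξ) * U) a b) (Matrix.diagonal l a b)
      (frameDeriv (frameData v ψ x U l c).G ξ a b)
      (∑ i, ∑ j, U i a * U j b * ((∑ k, ∑ m, ξ k * ξ m * pd4 v i j k m x) / 2)) := by
  have h := HasJet.sum Finset.univ fun i _ => HasJet.sum Finset.univ fun j _ =>
    (hasJet_pd2 hv ξ i j).const_mul (U i a * U j b)
  have e : (fun t : ℝ => (U.transpose * hessM v (x + t • ξ) * U) a b)
      = fun t => ∑ i, ∑ j, U i a * U j b * pd2 v i j (x + t • ξ) := funext fun t => by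
    rw [Finset.sum_comm]
    simp only [Matrix.mul_apply, Matrix.transpose_apply, Finset.sum_mul, hessM, Matrix.of_apply]
    exact Finset.sum_congr rfl fun j _ => Finset.sum_congr rfl fun i _ => by ring
  rw [e]
  refine h.congr ?_ ?_ rfl
  · simpa [hessM] using hU.sum_sum_eq a b
  · simp only [frameDeriv, frameData, Finset.mul_sum]
    have : ∀ i, ∑ j, ∑ k, U i a * U j b * (ξ k * pd3 v i j k x)
        = ∑ k, ∑ j, U i a * U j b * (ξ k * pd3 v i j k x) := fun i => Finset.sum_comm
    simp only [this]
    rw [Finset.sum_comm]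
    refine Finset.sum_congr rfl fun k _ => ?_
    rw [Finset.sum_comm]
    exact Finset.sum_congr rfl fun i _ => Finset.sum_congr rfl fun j _ => by ring

theorem sum_eq_frameDeriv₂ (ξ : Fin 4 → ℝ) (a : Fin 4) :
    ∑ i, ∑ j, U i a * U j a * ((∑ k, ∑ m, ξ k * ξ m * pd4 v i j k m x) / 2)
      = frameDeriv₂ (frameData v ψ x U l c).Z ξ a / 2 := by
  have e : ∀ i j, U i a * U j a * ((∑ k, ∑ m, ξ k * ξ m * pd4 v i j k m x) / 2)
      = ∑ k, ∑ m, ξ k * ξ m * (U i a * U j a * pd4 v i j k m x) / 2 := fun i j => by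
    simp only [Finset.sum_div, Finset.mul_sum]
    exact Finset.sum_congr rfl fun k _ => Finset.sum_congr rfl fun m _ => by ring
  simp only [e]
  simp only [frameDeriv₂, frameData, Finset.sum_div, Finset.mul_sum]
  have e1 : ∀ i, ∑ j, ∑ k, ∑ m, ξ k * ξ m * (U i a * U j a * pd4 v i j k m x) / 2
      = ∑ k, ∑ m, ∑ j, ξ k * ξ m * (U i a * U j a * pd4 v i j k m x) / 2 := fun i => by
    rw [Finset.sum_comm]
    exact Finset.sum_congr rfl fun k _ => Finset.sum_comm
  simp only [e1]
  rw [Finset.sum_comm]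
  exact Finset.sum_congr rfl fun k _ => Finset.sum_comm

/-- Comparison of a test function touching `phiBG` from below with the smooth barrier. -/
theorem touch (hv : ContDiffAt ℝ 4 v x) (hpsd : ∀ᶠ y in nhds x, (hessM v y).PosSemidef)
    (hU : IsEigenframe (hessM v x) U l) (hsum : ∑ a, c a = 1) (hcl : ∀ a, c a * l a = c 0 * l 0)
    (hc : (if 0 < sigma3 (Matrix.diagonal l) then
      (Matrix.diagonal l).det / sigma3 (Matrix.diagonal l) else 0) = ∑ a, c a ^ 2 * l a)
    (hψ : ContDiffAt ℝ 2 ψ x) (hx : ψ x = phiBG v x) (hle : ∀ᶠ y in nhds x, ψ y ≤ phiBG v y)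
    (ξ : Fin 4 → ℝ) (D : Fin 4 → Fin 4 → ℝ) (hD : ∑ a, D a a = 0) :
    (∑ i, ξ i * pd ψ i x = ∑ a, (sigma2Compl l a + c a ^ 2)
        * frameDeriv (frameData v ψ x U l c).G ξ a a) ∧
    ∑ i, ∑ j, ξ i * ξ j * pd2 ψ i j x
      ≤ ∑ a, (sigma2Compl l a + c a ^ 2) * frameDeriv₂ (frameData v ψ x U l c).Z ξ a
        + sigma3Quad l (frameDeriv (frameData v ψ x U l c).G ξ)
        + 4 * ∑ a, ∑ b, D a b * frameDeriv (frameData v ψ x U l c).G ξ a b * c b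
        + 2 * ∑ a, ∑ b, l a * D a b ^ 2 := by
  have hX : ∀ a b, frameDeriv (frameData v ψ x U l c).G ξ a b
      = frameDeriv (frameData v ψ x U l c).G ξ b a := fun a b => by
    simp only [frameDeriv, frameData, Finset.mul_sum]
    refine Finset.sum_congr rfl fun k _ => ?_
    rw [Finset.sum_comm]
    exact Finset.sum_congr rfl fun i _ => Finset.sum_congr rfl fun j _ => by
      rw [pd3_symm_left hv]
      ring
  have hM : ∀ᶠ y in nhds x, ∀ i j, (U.transpose * hessM v y * U) i j
      = (U.transpose * hessM v y * U) j i := hpsd.mono fun y hy i j => by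
    simpa using congrFun₂ (hy.conjTranspose_mul_mul_same U).isHermitian.eq j i
  have j1 := (HasJet.sigma3 ((tendsto_line x ξ).eventually hM) fun a b => hasJet_conj (ψ := ψ) (c := c) hv hU ξ a b).add
    (HasJet.traceQuad hX hD hcl fun a b => hasJet_conj hv hU ξ a b)
  have j2 := HasJet.line hψ ξ
  have e0 : ψ x = sigma3 (Matrix.diagonal l) + ∑ a, c a ^ 2 * l a := by
    rw [hx, phiBG, ← hc, ← hU.diag, hU.sigma3_conj, hU.det_conj]
  have cmp : ∀ y, ψ y ≤ phiBG v y → (hessM v y).PosSemidef → ∀ C : Matrix (Fin 4) (Fin 4) ℝ,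
      C.trace = 1 → ψ y ≤ sigma3 (U.transpose * hessM v y * U)
        + traceQuad C (U.transpose * hessM v y * U) := fun y hy hp C hC => by
    refine hy.trans ?_
    have h1 := quotient_le_traceQuad (M := U.transpose * hessM v y * U)
      (by simpa using hp.conjTranspose_mul_mul_same U) hC
    rw [hU.sigma3_conj, hU.det_conj] at h1
    rw [hU.sigma3_conj, phiBG]
    linarith
  have key := (j2.congr e0 rfl rfl).le j1 (by
    filter_upwards [(tendsto_line x ξ).eventually hle, (tendsto_line x ξ).eventually hpsd]
      with t h1 h2
    exact cmp _ h1 h2 _ (by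
      rw [Matrix.trace_add, Matrix.trace_diagonal, Matrix.trace_smul, hsum]
      simp [Matrix.trace, hD]))
  simp only [sum_eq_frameDeriv₂ (ψ := ψ) (l := l) (c := c)] at key
  refine ⟨?_, ?_⟩
  · rw [key.1]
    simp only [add_mul, Finset.sum_add_distrib]
  · have k2 := key.2
    simp only [add_mul, Finset.sum_add_distrib]
    simp only [mul_div_assoc', ← Finset.sum_div] at k2
    linarith

end Point

theorem polarDet_variation {v ψ : (Fin 4 → ℝ) → ℝ} {x : Fin 4 → ℝ}
    {U : Matrix (Fin 4) (Fin 4) ℝ} {l c : Fin 4 → ℝ} {lam : ℝ} (hv : ContDiffAt ℝ 4 v x)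
    (hstar : ∀ᶠ y in nhds x, polarDet (shiftM v y) (shiftM v y) = 2 * lam)
    (hU : IsEigenframe (hessM v x) U l) (a : Fin 4) :
    polarDet (shiftM v x) (gradShift₁ l (frameData v ψ x U l c).p (frameData v ψ x U l c).e
        (frameData v ψ x U l c).Xo a) = 0 ∧
    polarDet (shiftM v x) (gradShift₂ l (frameData v ψ x U l c).p (frameData v ψ x U l c).e
        (frameData v ψ x U l c).G (frameData v ψ x U l c).Z a)
      + polarDet (gradShift₁ l (frameData v ψ x U l c).p (frameData v ψ x U l c).e
          (frameData v ψ x U l c).Xo a)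
        (gradShift₁ l (frameData v ψ x U l c).p (frameData v ψ x U l c).e
          (frameData v ψ x U l c).Xo a) = 0 := by
  have h := HasJet.polarDet fun i j => hasJet_shiftM (ψ := ψ) (c := c) hv hU a i j
  have h0 : polarDet (fun i j => shiftM v x i j) (fun i j => shiftM v x i j) = 2 * lam :=
    hstar.self_of_nhds
  have h1 := (h.congr h0 rfl rfl).unique (HasJet.const (2 * lam))
    ((tendsto_line x fun k => U k a).eventually hstar)
  refine ⟨by linarith [h1.1], ?_⟩
  rw [← h1.2]
  simp only [polarDet]
  ring

theorem frameData_good {v ψ : (Fin 4 → ℝ) → ℝ} {x : Fin 4 → ℝ} {U : Matrix (Fin 4) (Fin 4) ℝ}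
    {l c : Fin 4 → ℝ} {lam m α β R : ℝ} (hv : ContDiffAt ℝ 4 v x)
    (hstar : ∀ᶠ y in nhds x, polarDet (shiftM v y) (shiftM v y) = 2 * lam)
    (hpsd : ∀ᶠ y in nhds x, (hessM v y).PosSemidef)
    (hU : IsEigenframe (hessM v x) U l) (hl : ∀ a, 0 ≤ l a)
    (hc0 : ∀ a, 0 ≤ c a) (hsum : ∑ a, c a = 1) (hcl : ∀ a, c a * l a = c 0 * l 0)
    (hcb : 1 / 2 ≤ c 0 + c 1)
    (hc : (if 0 < sigma3 (Matrix.diagonal l) then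
      (Matrix.diagonal l).det / sigma3 (Matrix.diagonal l) else 0) = ∑ a, c a ^ 2 * l a)
    (hψ : ContDiffAt ℝ 2 ψ x) (hx : ψ x = phiBG v x) (hle : ∀ᶠ y in nhds x, ψ y ≤ phiBG v y)
    (h1 : ∀ i, |pd v i x| ≤ m) (h2 : ∀ i j, |pd2 v i j x| ≤ m)
    (h3 : ∀ i j k, |pd3 v i j k x| ≤ m) (h4 : ∀ i j k n, |pd4 v i j k n x| ≤ m)
    (hm : 0 ≤ m) (hmR : 64 * m ≤ R) (hR : 1 ≤ R)
    (hα : α ≤ shiftM v x 1 1 + shiftM v x 3 3) (hαR : R⁻¹ ≤ α) (hβ2 : β ≤ l 2) (hβ3 : β ≤ l 3) (hβR : R⁻¹ ≤ β) :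
    (frameData v ψ x U l c).Good lam R where
  p_le i := (h1 i).trans (by linarith)
  e_le a i := (hU.abs_le_one i a).trans hR
  l_le a := (hU.abs_eigenvalue_le (fun i j => h2 i j) a).trans (by linarith)
  X3_le a b d := (abs_sum_mul_le (fun i => hU.abs_le_one i d) fun i =>
    abs_sum_mul_le (fun j => hU.abs_le_one j b) fun j =>
      abs_sum_mul_le (fun k => hU.abs_le_one k a) fun k => h3 k j i).trans (by linarith)
  Z_le a i j := by
    have : (frameData v ψ x U l c).Z a i j = ∑ k, U k a * ∑ n, U n a * pd4 v k n i j x := by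
      simp only [frameData, Finset.mul_sum, mul_assoc]
    rw [this]
    exact (abs_sum_mul_le (fun k => hU.abs_le_one k a) fun k =>
      abs_sum_mul_le (fun n => hU.abs_le_one n a) fun n => h4 k n i j).trans (by linarith)
  l_nonneg := hl
  c_nonneg := hc0
  sum_c := hsum
  c_mul := hcl
  l_two := hβR.trans hβ2
  l_three := hβR.trans hβ3
  c_big := hcb
  coeff_big := (hαR.trans hα).trans_eq (by
    rw [← gradShift_frameData (ψ := ψ) (c := c) hU]
    rfl)
  e_norm := hU.sum_mul_self 3
  X3_symm a b d := by
    simp only [frameData, Finset.mul_sum]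
    refine Finset.sum_congr rfl fun k _ => ?_
    rw [Finset.sum_comm]
    exact Finset.sum_congr rfl fun i _ => Finset.sum_congr rfl fun j _ => by
      rw [pd3_symm_left hv]
      ring
  X3_symm' a b d := by
    simp only [frameData, Finset.mul_sum]
    rw [Finset.sum_comm]
    exact Finset.sum_congr rfl fun k _ => Finset.sum_congr rfl fun i _ =>
      Finset.sum_congr rfl fun j _ => by
        rw [pd3_symm_right hv]
        ring
  G_eq a b i := by
    rw [← hU.sum_expand ((frameData v ψ x U l c).G a b) i]
    exact Finset.sum_congr rfl fun k _ => mul_comm _ _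
  X3_eq a b d := rfl
  Xo_eq a i j := by
    rw [← hU.sum_expand (fun i => (frameData v ψ x U l c).Xo a i j) i]
    refine Finset.sum_congr rfl fun b _ => ?_
    have := hU.sum_expand ((frameData v ψ x U l c).G a b) j
    have e : ∑ k, U k b * (frameData v ψ x U l c).Xo a k j = (frameData v ψ x U l c).G a b j := rfl
    rw [e, ← this, Finset.mul_sum]
    exact Finset.sum_congr rfl fun k _ => (mul_assoc _ _ _).symm
  Z_symm a i j := by
    simp only [frameData]
    exact Finset.sum_congr rfl fun k _ => Finset.sum_congr rfl fun n _ => by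
      rw [pd4_symm_right hv]
  star₀ := by
    rw [← hstar.self_of_nhds]
    exact congrArg₂ polarDet (gradShift_frameData hU) (gradShift_frameData hU)
  star₁ a := by
    have h := (polarDet_variation hv hstar hU (ψ := ψ) (c := c) a).1
    rw [← gradShift_frameData (ψ := ψ) (c := c) hU] at h
    exact h
  star₂ a := by
    have h := (polarDet_variation hv hstar hU (ψ := ψ) (c := c) a).2
    rw [← gradShift_frameData (ψ := ψ) (c := c) hU] at h
    exact h
  touch₁ ξ := (touch hv hpsd hU hsum hcl hc hψ hx hle ξ 0 (by simp)).1
  touch₂ ξ D hD := (touch hv hpsd hU hsum hcl hc hψ hx hle ξ D hD).2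

theorem exists_eventually_abs_le {ι X : Type*} [Fintype ι] [TopologicalSpace X] {x₀ : X}
    {f : ι → X → ℝ} (hf : ∀ i, ContinuousAt (f i) x₀) :
    ∃ m, 0 < m ∧ ∀ᶠ y in nhds x₀, ∀ i, |f i y| ≤ m := by
  have h : ContinuousAt (fun y => ∑ i, |f i y|) x₀ :=
    tendsto_finsetSum _ fun i _ => (hf i).abs
  refine ⟨∑ i, |f i x₀| + 1, by positivity, ?_⟩
  filter_upwards [h.eventually (gt_mem_nhds (lt_add_one _))] with y hy i
  exact (Finset.single_le_sum (f := fun i => |f i y|) (fun _ _ => abs_nonneg _)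
    (Finset.mem_univ i)).trans hy.le

theorem exists_eventually_derivatives_le {v : (Fin 4 → ℝ) → ℝ} {x₀ : Fin 4 → ℝ}
    (hv : ContDiffAt ℝ 4 v x₀) :
    ∃ m, 0 < m ∧ ∀ᶠ y in nhds x₀, (∀ i, |pd v i y| ≤ m) ∧ (∀ i j, |pd2 v i j y| ≤ m) ∧
      (∀ i j k, |pd3 v i j k y| ≤ m) ∧ ∀ i j k n, |pd4 v i j k n y| ≤ m := by
  obtain ⟨m₁, p₁, h₁⟩ := exists_eventually_abs_le fun i => continuousAt_pd hv i
  obtain ⟨m₂, p₂, h₂⟩ := exists_eventually_abs_le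
    fun i : Fin 4 × Fin 4 => continuousAt_pd2 hv i.1 i.2
  obtain ⟨m₃, p₃, h₃⟩ := exists_eventually_abs_le
    fun i : Fin 4 × Fin 4 × Fin 4 => continuousAt_pd3 hv i.1 i.2.1 i.2.2
  obtain ⟨m₄, p₄, h₄⟩ := exists_eventually_abs_le
    fun i : Fin 4 × Fin 4 × Fin 4 × Fin 4 => continuousAt_pd4 hv i.1 i.2.1 i.2.2.1 i.2.2.2
  refine ⟨m₁ + m₂ + m₃ + m₄, by positivity, ?_⟩
  filter_upwards [h₁, h₂, h₃, h₄] with y h₁ h₂ h₃ h₄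
  refine ⟨fun i => ?_, fun i j => ?_, fun i j k => ?_, fun i j k n => ?_⟩
  · linarith [h₁ i]
  · linarith [h₂ (i, j)]
  · linarith [h₃ (i, j, k)]
  · linarith [h₄ (i, j, k, n)]

theorem continuousAt_hessM {v : (Fin 4 → ℝ) → ℝ} {x₀ : Fin 4 → ℝ} (hv : ContDiffAt ℝ 4 v x₀) :
    ContinuousAt (hessM v) x₀ :=
  continuousAt_pi.2 fun i => continuousAt_pi.2 fun j => continuousAt_pd2 hv i j

/-- Near a point where the Hessian has rank two, the second elementary symmetric function of the
Hessian is bounded below and the third one is small. -/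
theorem eventually_sigma_bounds {v : (Fin 4 → ℝ) → ℝ} {x₀ : Fin 4 → ℝ}
    (hv : ContDiffAt ℝ 4 v x₀) (hpsd : (hessM v x₀).PosSemidef) (hr : (hessM v x₀).rank = 2)
    {m : ℝ} (hm : 0 < m) :
    ∃ β, 0 < β ∧ ∀ᶠ y in nhds x₀,
      12 * m * β ≤ (hessM v y).trace ^ 2 - (hessM v y * hessM v y).trace ∧
      4 * sigma3 (hessM v y) ≤ β ^ 3 := by
  obtain ⟨U, l, hU, hl⟩ := exists_isEigenframe hpsd
  obtain ⟨z1, p2⟩ := hU.of_rank_two hl hr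
  have z0 : l 0 = 0 := le_antisymm (z1 ▸ hU.mono (by decide)) (hl 0)
  have p3 : 0 < l 3 := p2.trans_le (hU.mono (by decide))
  have hβ : 0 < l 2 * l 3 / (12 * m) := by positivity
  have c1 : ContinuousAt (fun y => (hessM v y).trace ^ 2 - (hessM v y * hessM v y).trace) x₀ :=
    ContinuousAt.comp (f := hessM v)
      (g := fun M : Matrix (Fin 4) (Fin 4) ℝ => M.trace ^ 2 - (M * M).trace)
      (Continuous.continuousAt (by fun_prop)) (continuousAt_hessM hv)
  have c2 : ContinuousAt (fun y => 4 * sigma3 (hessM v y)) x₀ :=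
    ContinuousAt.comp (f := hessM v) (g := fun M : Matrix (Fin 4) (Fin 4) ℝ => 4 * sigma3 M)
      (Continuous.continuousAt (by unfold sigma3; fun_prop)) (continuousAt_hessM hv)
  refine ⟨l 2 * l 3 / (12 * m), hβ, ?_⟩
  have h1 : 12 * m * (l 2 * l 3 / (12 * m)) <
      (hessM v x₀).trace ^ 2 - (hessM v x₀ * hessM v x₀).trace := by
    rw [hU.trace_eq, hU.trace_mul_self, Fin.sum_univ_four, Fin.sum_univ_four, z0, z1,
      mul_div_cancel₀ _ (by positivity)]
    nlinarith [mul_pos p2 p3]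
  have h2 : 4 * sigma3 (hessM v x₀) < (l 2 * l 3 / (12 * m)) ^ 3 := by
    rw [hU.sigma3_eq, z0, z1]
    simp only [zero_mul, add_zero, mul_zero]
    positivity
  filter_upwards [c1.eventually_const_lt h1, c2.eventually_lt_const h2] with y h1 h2
  exact ⟨h1.le, h2.le⟩

theorem sigma3_le_phiBG {v : (Fin 4 → ℝ) → ℝ} {x : Fin 4 → ℝ} (h : (hessM v x).PosSemidef) :
    sigma3 (hessM v x) ≤ phiBG v x := by
  rw [phiBG]
  refine le_add_of_nonneg_right ?_
  split_ifs with hs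
  · exact div_nonneg h.det_nonneg hs.le
  · exact le_rfl

theorem sum_abs_le_sqrt (g : Fin 4 → ℝ) : ∑ i, |g i| ≤ 4 * Real.sqrt (∑ i, g i ^ 2) := by
  refine (Finset.sum_le_sum (g := fun _ => Real.sqrt (∑ i, g i ^ 2)) fun i _ => ?_).trans_eq
    (by simp)
  exact Real.abs_le_sqrt (Finset.single_le_sum (f := fun i => g i ^ 2) (fun _ _ => sq_nonneg _)
    (Finset.mem_univ i))

/-- differential inequality for Bian–Guan's auxiliary function when
the minimal rank of the Hessian is `2`, the inequality being understood in the
viscosity sense (via `C²` test functions touching `φ` from below). -/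
theorem diff_ineq_minimal_rank_two
    (Ω : Set (Fin 4 → ℝ)) (hΩ : IsOpen Ω) (hconn : IsConnected Ω)
    (lam : ℝ) (hlam : 0 < lam)
    (v : (Fin 4 → ℝ) → ℝ) (hv : ContDiffOn ℝ 4 v Ω)
    (hconv : ConvexOn ℝ Ω v)
    (hstar : StarEq lam v Ω)
    (x₀ : Fin 4 → ℝ) (hx₀ : x₀ ∈ Ω)
    (hrank : ∀ x ∈ Ω, 2 ≤ (hessM v x).rank)
    (hmin : (hessM v x₀).rank = 2) :
    ∃ O : Set (Fin 4 → ℝ), IsOpen O ∧ x₀ ∈ O ∧ O ⊆ Ω ∧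
      ∃ C : ℝ, 0 < C ∧
        ∀ x ∈ O, ∀ ψ : (Fin 4 → ℝ) → ℝ, ContDiffAt ℝ 2 ψ x →
          ψ x = phiBG v x → (∀ᶠ y in nhds x, ψ y ≤ phiBG v y) →
          ∑ i : Fin 4, ∑ j : Fin 4, Fm v x i j * pd2 ψ i j x ≤
            C * (phiBG v x + Real.sqrt (∑ i : Fin 4, (pd ψ i x)^2)) := by
  have hv4 : ∀ x ∈ Ω, ContDiffAt ℝ 4 v x := fun x hx => hv.contDiffAt (hΩ.mem_nhds hx)
  have hpsd : ∀ x ∈ Ω, (hessM v x).PosSemidef := fun x hx =>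
    hessM_posSemidef (hΩ.mem_nhds hx) hconv ((hv4 x hx).of_le (by norm_num))
  obtain ⟨m, hm, hder⟩ := exists_eventually_derivatives_le (hv4 x₀ hx₀)
  obtain ⟨β, hβ, hσ⟩ := eventually_sigma_bounds (hv4 x₀ hx₀) (hpsd x₀ hx₀) hmin
    (m := 4 * (4 * m)) (by positivity)
  have hα := shiftM_pos hlam (hstar.polarDet_shiftM hx₀) (hpsd x₀ hx₀)
  set α := (shiftM v x₀ 1 1 + shiftM v x₀ 3 3) / 2 with hαd
  have hcoeff : ∀ᶠ y in nhds x₀, α < shiftM v y 1 1 + shiftM v y 3 3 := by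
    have hc : ∀ i, ContinuousAt (fun y => shiftM v y i i) x₀ := fun i =>
      (continuousAt_pd2 (hv4 x₀ hx₀) i i).sub
        ((continuousAt_pd (hv4 x₀ hx₀) i).mul (continuousAt_pd (hv4 x₀ hx₀) i))
    exact ((hc 1).add (hc 3)).eventually (lt_mem_nhds (half_lt_self hα))
  have hΩ₀ : ∀ᶠ y in nhds x₀, y ∈ Ω := hΩ.mem_nhds hx₀
  obtain ⟨O, hO, hOo, hxO⟩ := eventually_nhds_iff.1 (hΩ₀.and (hder.and (hσ.and hcoeff)))
  have hαp : 0 < α := half_pos hα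
  have hR : 0 < 1 + 64 * m + α⁻¹ + β⁻¹ := by positivity
  obtain ⟨C, hC, hest⟩ := FrameData.Good.estimate lam (1 + 64 * m + α⁻¹ + β⁻¹) hlam hR
  refine ⟨O, hOo, hxO, fun x hx => (hO x hx).1, C * (2 * (β ^ 2)⁻¹ + 4), by positivity, ?_⟩
  intro x hx ψ hψ hψx hψle
  obtain ⟨hxΩ, ⟨h1, h2, h3, h4⟩, ⟨hβσ, hσβ⟩, hxα⟩ := hO x hx
  obtain ⟨U, l, hU, hl⟩ := exists_isEigenframe (hpsd x hxΩ)
  have hlm : ∀ a, l a ≤ 4 * (4 * m) := fun a =>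
    (le_abs_self _).trans (hU.abs_eigenvalue_le (fun i j => h2 i j) a)
  obtain ⟨hβ2, hβ3, hβ1⟩ := hU.bounds hl (by positivity) hlm hβ hβσ
  have h01 : l 0 ≤ l 1 := hU.mono (by decide)
  have h0β : 4 * l 0 ≤ β := by
    refine le_of_mul_le_mul_left (a := β ^ 2) ?_ (by positivity)
    nlinarith [sq_nonneg β]
  obtain ⟨c, hc0, hcs, hcl, hcb, hcq⟩ := exists_weights hl hU.mono hβ hβ2 h0β
  have hΩx : ∀ᶠ y in nhds x, y ∈ Ω := hΩ.mem_nhds hxΩ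
  have hstar' : ∀ᶠ y in nhds x, polarDet (shiftM v y) (shiftM v y) = 2 * lam :=
    hΩx.mono fun y hy => hstar.polarDet_shiftM hy
  have hαi := inv_pos.2 hαp
  have hβi := inv_pos.2 hβ
  have hgood := frameData_good (R := 1 + 64 * m + α⁻¹ + β⁻¹) (hv4 x hxΩ) hstar'
    (hΩx.mono hpsd) hU hl hc0 hcs hcl hcb hcq hψ hψx hψle h1 h2 h3 h4 hm.le
    (by linarith) (by linarith) hxα.le (inv_le_of_inv_le₀ hαp (by linarith)) hβ2 hβ3
    (inv_le_of_inv_le₀ hβ (by linarith))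
  have hmain := hest _ hgood
  rw [show gradShift (frameData v ψ x U l c).l (frameData v ψ x U l c).p (frameData v ψ x U l c).e
    = shiftM v x from gradShift_frameData hU] at hmain
  have hsymm : ∀ i j, pd2 ψ i j x = pd2 ψ j i x := pd2_symm hψ
  rw [show (frameData v ψ x U l c).hess = fun i j => pd2 ψ i j x from rfl,
    sum_coeffWeight_frameDeriv _ _ _ _ (mul_inv_cancel₀ (hαp.trans hxα).ne') (by
      have := hstar.polarDet_shiftM hxΩ
      simp only [polarDet] at this
      linarith) hsymm, ← sum_Fm_mul v x hsymm] at hmain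
  refine hmain.trans ?_
  rw [mul_assoc]
  refine mul_le_mul_of_nonneg_left ?_ hC.le
  have hg : ∑ i, |(frameData v ψ x U l c).grad i| ≤ 4 * Real.sqrt (∑ i, pd ψ i x ^ 2) :=
    sum_abs_le_sqrt _
  have hφ := sigma3_le_phiBG (hpsd x hxΩ)
  have hl1 : l 1 ≤ (β ^ 2)⁻¹ * phiBG v x := by
    rw [le_inv_mul_iff₀ (by positivity)]
    exact hβ1.trans hφ
  have hφ0 : 0 ≤ phiBG v x := (mul_nonneg (sq_nonneg β) (hl 1)).trans (hβ1.trans hφ)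
  have hs := Real.sqrt_nonneg (∑ i, pd ψ i x ^ 2)
  have hs' : 0 ≤ 2 * (β ^ 2)⁻¹ * Real.sqrt (∑ i, pd ψ i x ^ 2) := by positivity
  change l 0 + l 1 + _ ≤ _
  linarith
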